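/- arXiv:2204.01997 — 3 statements merged into one kernel-verified Lean document; each statement's English description precedes it below -/
import Mathlib

section
/- Let F be a dyadic local field with e = ord(2). For a, b ∈ F^×, if d(a) + d(b) > 2e, then the Hilbert symbol (a,b)_𝔭 equals 1. -/
noncomputable section
open scoped Classical

/-- A normalized discrete valuation on a field, written additively with values in `ℤ ∪ {∞}`. -/
structure NormDiscValuation (F : Type*) [Field F] : Type _ where
  v : F → WithTop ℤ
  v_zero : v 0 = ⊤
  v_ne_top : ∀ x : F, x ≠ 0 → v x ≠ ⊤
  v_mul : ∀ x y : F, v (x * y) = v x + v y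
  v_add : ∀ x y : F, min (v x) (v y) ≤ v (x + y)
  v_surj : ∀ k : ℤ, ∃ x : F, v x = (k : WithTop ℤ)

variable {F : Type*}

/-- The order of the relative quadratic defect: `d(c) = ord (c⁻¹ 𝔡(c))`, where
`𝔡(c) = ⋂_{x ∈ F} (c - x²) 𝒪_F`; the order of this intersection of principal fractional
ideals is the supremum of the orders `ord ((c - x²)/c)`. -/
def relDefect [Field F] (V : NormDiscValuation F) (c : F) : WithTop ℤ :=
  ⨆ x : F, V.v ((c - x ^ 2) / c)

/-- `(a, b)_𝔭 = 1` for the Hilbert symbol: `z² = a x² + b y²` has a nontrivial solution. -/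
def HilbertOne [Field F] (a b : F) : Prop := ∃ x y : F, a * x ^ 2 + b * y ^ 2 = 1

namespace NormDiscValuation

section Basic

variable [Field F] (V : NormDiscValuation F)

theorem exists_int_eq {x : F} (hx : x ≠ 0) : ∃ n : ℤ, V.v x = n :=
  (WithTop.ne_top_iff_exists.mp (V.v_ne_top x hx)).imp fun _ h => h.symm

theorem v_one : V.v 1 = 0 := by
  obtain ⟨n, hn⟩ := V.exists_int_eq (one_ne_zero (α := F))
  have h := V.v_mul 1 1
  rw [mul_one, hn] at h
  norm_cast at h
  rw [hn]
  norm_cast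
  omega

theorem v_pow (x : F) (n : ℕ) : V.v (x ^ n) = n • V.v x := by
  induction n with
  | zero => simpa using V.v_one
  | succ n ih => rw [pow_succ, V.v_mul, ih, succ_nsmul]

theorem v_pow_of_eq_int {x : F} {c : ℤ} (hx : V.v x = c) (n : ℕ) :
    V.v (x ^ n) = ((n * c : ℤ) : WithTop ℤ) := by
  rw [V.v_pow, hx, ← WithTop.coe_nsmul, nsmul_eq_mul]

theorem v_one_add_of_neg {x : F} (hx : V.v x < 0) : V.v (1 + x) = V.v x := by
  have hneg : V.v (-1) = 0 := by
    obtain ⟨n, hn⟩ := V.exists_int_eq (neg_ne_zero.mpr (one_ne_zero (α := F)))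
    have h := V.v_mul (-1) (-1)
    rw [neg_one_mul, neg_neg, V.v_one, hn] at h
    norm_cast at h
    rw [hn]
    norm_cast
    omega
  have h1 := V.v_add 1 x
  have h2 := V.v_add (1 + x) (-1)
  rw [V.v_one, min_eq_right hx.le] at h1
  rw [add_neg_cancel_comm, hneg] at h2
  rcases min_le_iff.mp h2 with h | h
  · exact le_antisymm h h1
  · exact absurd h hx.not_ge

theorem exists_le_of_le_relDefect {c : F} {n : ℤ} (h : (n : WithTop ℤ) ≤ relDefect V c) :
    ∃ x : F, (n : WithTop ℤ) ≤ V.v ((c - x ^ 2) / c) := by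
  have hlt : ((n - 1 : ℤ) : WithTop ℤ) < relDefect V c :=
    lt_of_lt_of_le (by norm_cast; omega) h
  obtain ⟨x, hx⟩ := exists_lt_of_lt_ciSup hlt
  refine ⟨x, ?_⟩
  cases hv : V.v ((c - x ^ 2) / c) with
  | top => exact le_top
  | coe m =>
    rw [hv] at hx
    norm_cast at hx ⊢
    omega

/-- Two elements realizing the relative defects of `a` and `b` closely enough. -/
theorem exists_lt_add_of_lt_relDefect_add {a b : F} {N : ℤ}
    (h : (N : WithTop ℤ) < relDefect V a + relDefect V b) :
    ∃ x y : F, (N : WithTop ℤ) < V.v ((a - x ^ 2) / a) + V.v ((b - y ^ 2) / b) := by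
  obtain ⟨m, n, hm, hn, hmn⟩ : ∃ m n : ℤ, (m : WithTop ℤ) ≤ relDefect V a ∧
      (n : WithTop ℤ) ≤ relDefect V b ∧ N < m + n := by
    cases ha : relDefect V a with
    | top =>
      cases hb : relDefect V b with
      | top => exact ⟨N, 1, le_top, le_top, by omega⟩
      | coe n => exact ⟨N - n + 1, n, le_top, le_rfl, by omega⟩
    | coe m =>
      cases hb : relDefect V b with
      | top => exact ⟨m, N - m + 1, le_rfl, le_top, by omega⟩
      | coe n =>
        rw [ha, hb] at h
        exact ⟨m, n, le_rfl, le_rfl, by exact_mod_cast h⟩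
  obtain ⟨x, hx⟩ := V.exists_le_of_le_relDefect hm
  obtain ⟨y, hy⟩ := V.exists_le_of_le_relDefect hn
  exact ⟨x, y, lt_of_lt_of_le (by exact_mod_cast hmn) (add_le_add hx hy)⟩

end Basic

end NormDiscValuation

section Ultrametric

variable [NormedField F] [CompleteSpace F] [IsUltrametricDist F]

/-- `t² + t + δ = 0` is solvable in the maximal ideal whenever `δ` lies there. -/
theorem exists_one_add_two_mul_sq_eq {δ : F} (hδ : ‖δ‖ < 1) :
    ∃ t : F, ‖t‖ ≤ ‖δ‖ ∧ (1 + 2 * t) ^ 2 = 1 - 4 * δ := by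
  let f : F → F := fun t => -δ + -t ^ 2
  let s : Set F := Metric.closedBall 0 ‖δ‖
  have hmaps : Set.MapsTo f s s := by
    intro t ht
    rw [mem_closedBall_zero_iff] at ht ⊢
    refine (IsUltrametricDist.norm_add_le_max _ _).trans (max_le (by simp) ?_)
    rw [norm_neg, norm_pow]
    nlinarith [norm_nonneg t]
  have hcontr : ContractingWith ‖δ‖₊ (hmaps.restrict f s s) := by
    refine ⟨by exact_mod_cast hδ, LipschitzWith.of_dist_le_mul fun x y => ?_⟩
    have hx := mem_closedBall_zero_iff.mp x.2
    have hy := mem_closedBall_zero_iff.mp y.2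
    have hadd : ‖(x : F) + y‖ ≤ ‖δ‖ :=
      (IsUltrametricDist.norm_add_le_max _ _).trans (max_le hx hy)
    rw [Subtype.dist_eq, Subtype.dist_eq, dist_eq_norm, dist_eq_norm]
    have heq : f x - f y = -(((x : F) + y) * (x - y)) := by simp only [f]; ring
    change ‖f x - f y‖ ≤ ‖δ‖ * ‖(x : F) - y‖
    rw [heq, norm_neg, norm_mul]
    gcongr
  obtain ⟨t, hts, ht, -⟩ := hcontr.exists_fixedPoint' (x := 0) Metric.isClosed_closedBall.isComplete
    hmaps (by simp [s]) (edist_ne_top _ _)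
  refine ⟨t, mem_closedBall_zero_iff.mp hts, ?_⟩
  have ht' : -δ + -t ^ 2 = t := ht
  linear_combination -4 * ht'

theorem exists_pow_two_pow_eq (h2 : ‖(2 : F)‖ < 1) (h20 : (2 : F) ≠ 0) (m : ℕ) :
    ∀ δ : F, ‖δ‖ < 1 → ∃ u : F, u ^ 2 ^ m = 1 + 2 ^ (m + 1) * δ := by
  induction m with
  | zero => exact fun δ _ => ⟨1 + 2 * δ, by simp⟩
  | succ m ih =>
    intro δ hδ
    have hpow : ‖(2 : F) ^ m‖ ≤ 1 := by
      rw [norm_pow]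
      exact pow_le_one₀ (norm_nonneg _) h2.le
    have hpos : 0 < ‖(2 : F) ^ m‖ := norm_pos_iff.mpr (pow_ne_zero _ h20)
    have hlt : ‖-(2 ^ m * δ)‖ < 1 := by
      rw [norm_neg, norm_mul]
      nlinarith [norm_nonneg δ]
    obtain ⟨t, ht, htsq⟩ := exists_one_add_two_mul_sq_eq hlt
    rw [norm_neg, norm_mul] at ht
    have hdiv : ‖t / 2 ^ m‖ < 1 := by
      rw [norm_div, div_lt_one hpos]
      nlinarith
    obtain ⟨u, hu⟩ := ih _ hdiv
    refine ⟨u, ?_⟩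
    have : (1 : F) + 2 ^ (m + 1) * (t / 2 ^ m) = 1 + 2 * t := by
      field_simp
      ring
    rw [pow_succ 2 m, pow_mul, hu, this, htsq]
    ring

namespace NormDiscValuation

variable (V : NormDiscValuation F)

/-- Any normalized discrete valuation is nonnegative on the closed unit ball. -/
theorem v_nonneg_of_norm_le_one (h2 : ‖(2 : F)‖ < 1) (h20 : (2 : F) ≠ 0) {x : F}
    (hx : ‖x‖ ≤ 1) : 0 ≤ V.v x := by
  by_contra! hneg
  have hx0 : x ≠ 0 := by
    rintro rfl
    simp [V.v_zero] at hneg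
  obtain ⟨c, hc⟩ := V.exists_int_eq hx0
  obtain ⟨e, he⟩ := V.exists_int_eq h20
  have hc0 : c < 0 := by
    rw [hc] at hneg
    exact_mod_cast hneg
  -- every large multiple of `c`, suitably shifted, is divisible by `2 ^ m`
  have key (m k : ℕ) (hk : (m + 2) * e + k * c < 0) : (2 : ℤ) ^ m ∣ (m + 2) * e + k * c := by
    have hδ : ‖2 * x ^ k‖ < 1 := by
      rw [norm_mul, norm_pow]
      exact mul_lt_one_of_nonneg_of_lt_one_left (norm_nonneg _) h2
        (pow_le_one₀ (norm_nonneg _) hx)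
    obtain ⟨u, hu⟩ := exists_pow_two_pow_eq h2 h20 m _ hδ
    have hv : V.v (2 ^ (m + 1) * (2 * x ^ k)) = (((m + 2) * e + k * c : ℤ) : WithTop ℤ) := by
      rw [← mul_assoc, ← pow_succ, V.v_mul, V.v_pow_of_eq_int he, V.v_pow_of_eq_int hc]
      norm_cast
    have hv' : V.v (u ^ 2 ^ m) = (((m + 2) * e + k * c : ℤ) : WithTop ℤ) := by
      rw [hu, V.v_one_add_of_neg, hv]
      rw [hv]
      exact_mod_cast hk
    have hu0 : u ≠ 0 := by
      rintro rfl
      rw [zero_pow (by positivity), V.v_zero] at hv'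
      exact WithTop.top_ne_coe hv'
    obtain ⟨d, hd⟩ := V.exists_int_eq hu0
    rw [V.v_pow_of_eq_int hd] at hv'
    refine ⟨d, ?_⟩
    have := WithTop.coe_injective hv'
    push_cast at this
    exact this.symm
  set m := c.natAbs
  set k := ((m + 2) * e).natAbs + 1
  have hk : (m + 2) * e + k * c < 0 := by
    have h1 : (k : ℤ) = |((m + 2) * e : ℤ)| + 1 := by simp [k]
    have h3 := le_abs_self ((m + 2) * e : ℤ)
    have h4 := abs_nonneg ((m + 2) * e : ℤ)
    nlinarith
  have h1 := key m k hk
  have h3 := key m (k + 1) (by push_cast; linarith)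
  have hdvd : (2 : ℤ) ^ m ∣ c := by
    have := dvd_sub h3 h1
    push_cast at this
    ring_nf at this
    exact this
  have hle := Int.le_of_dvd (by omega) ((dvd_neg (a := (2 : ℤ) ^ m)).mpr hdvd)
  have hlt : (m : ℤ) < 2 ^ m := by exact_mod_cast Nat.lt_two_pow_self
  omega

theorem norm_lt_one_of_v_pos (h2 : ‖(2 : F)‖ < 1) (h20 : (2 : F) ≠ 0) {x : F}
    (hx : 0 < V.v x) : ‖x‖ < 1 := by
  by_contra! h
  have hx0 : x ≠ 0 := norm_pos_iff.mp (one_pos.trans_le h)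
  have hinv : 0 ≤ V.v x⁻¹ :=
    V.v_nonneg_of_norm_le_one h2 h20 (by rw [norm_inv]; exact inv_le_one_of_one_le₀ h)
  have hmul := V.v_mul x x⁻¹
  rw [mul_inv_cancel₀ hx0, V.v_one] at hmul
  exact (add_pos_of_pos_of_nonneg hx hinv).ne hmul

/-- The local square theorem. -/
theorem exists_sq_eq_one_sub (h2 : ‖(2 : F)‖ < 1) (h20 : (2 : F) ≠ 0) {e : ℤ}
    (he : V.v 2 = e) {γ : F} (hγ : ((2 * e : ℤ) : WithTop ℤ) < V.v γ) :
    ∃ w : F, w ^ 2 = 1 - γ := by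
  have h4 : γ = 2 ^ 2 * (γ / 2 ^ 2) := by field_simp
  have hpos : 0 < V.v (γ / 2 ^ 2) := by
    rw [h4, V.v_mul, V.v_pow_of_eq_int he] at hγ
    cases hv : V.v (γ / 2 ^ 2) with
    | top => exact WithTop.coe_lt_top 0
    | coe n =>
      rw [hv] at hγ
      norm_cast at hγ ⊢
      omega
  obtain ⟨t, -, ht⟩ := exists_one_add_two_mul_sq_eq (V.norm_lt_one_of_v_pos h2 h20 hpos)
  refine ⟨1 + 2 * t, ?_⟩
  rw [ht]
  field_simp
  ring

end NormDiscValuation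

end Ultrametric

/-- If `(1 - α) a` and `(1 - β) b` are squares and `1 - αβ` is a square, then `(a, b)_𝔭 = 1`. -/
theorem hilbertOne_of_sq_eq [Field F] (h20 : (2 : F) ≠ 0) {a b α β x y w : F}
    (ha : a ≠ 0) (hb : b ≠ 0) (hx : x ^ 2 = a * (1 - α)) (hy : y ^ 2 = b * (1 - β))
    (hw : w ^ 2 = 1 - α * β) (hw0 : w ≠ 0) : HilbertOne a b := by
  by_cases hα : α = 1
  · have hy0 : y ≠ 0 := by
      rintro rfl
      apply hw0
      have : 1 - β = 0 := by
        simpa [hb] using hy.symm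
      rw [← sq_eq_zero_iff, hw, hα, one_mul, this]
    refine ⟨0, w / y, ?_⟩
    subst hα
    field_simp
    rw [hw, hy]
    ring
  by_cases hβ : β = 1
  · have hx0 : x ≠ 0 := by
      rintro rfl
      simp [ha, sub_eq_zero, Ne.symm hα] at hx
    refine ⟨w / x, 0, ?_⟩
    subst hβ
    field_simp
    rw [hw, hx]
    ring
  have hα' : 1 - α ≠ 0 := sub_ne_zero.mpr (Ne.symm hα)
  have hβ' : 1 - β ≠ 0 := sub_ne_zero.mpr (Ne.symm hβ)
  -- `A (1 - z)² + B (1 - A)² = (z - A)²` for `A = 1 - α`, `B = 1 - β` and `z = ± w`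
  obtain ⟨z, hz, hzA⟩ : ∃ z : F, z ^ 2 = 1 - α * β ∧ z - (1 - α) ≠ 0 := by
    by_cases h : w - (1 - α) = 0
    · refine ⟨-w, by rw [neg_sq, hw], fun h' => ?_⟩
      have : 2 * (1 - α) = 0 := by linear_combination -h - h'
      exact mul_ne_zero h20 hα' this
    · exact ⟨w, hw, h⟩
  have hx0 : x ≠ 0 := by
    rintro rfl
    simp [ha, hα'] at hx
  have hy0 : y ≠ 0 := by
    rintro rfl
    simp [hb, hβ'] at hy
  refine ⟨(1 - α) * (1 - z) / (x * (z - (1 - α))), (1 - β) * α / (y * (z - (1 - α))), ?_⟩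
  have hax : a * ((1 - α) / x) ^ 2 = 1 - α := by
    rw [div_pow, hx]
    field_simp
  have hby : b * ((1 - β) / y) ^ 2 = 1 - β := by
    rw [div_pow, hy]
    field_simp
  have h1 : a * ((1 - α) * (1 - z) / (x * (z - (1 - α)))) ^ 2
      = (a * ((1 - α) / x) ^ 2) * ((1 - z) / (z - (1 - α))) ^ 2 := by
    field_simp
  have h2 : b * ((1 - β) * α / (y * (z - (1 - α)))) ^ 2
      = (b * ((1 - β) / y) ^ 2) * (α / (z - (1 - α))) ^ 2 := by
    field_simp
  rw [h1, h2, hax, hby, div_pow, div_pow, mul_div_assoc', mul_div_assoc', ← add_div,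
    div_eq_one_iff_eq (pow_ne_zero 2 hzA)]
  linear_combination (-α) * hz

/-- if `d(a) + d(b) > 2e` then `(a,b)_𝔭 = 1`. -/
theorem hilbert_one_of_relDefect_add_gt [Field F] [Algebra ℚ_[2] F]
    [FiniteDimensional ℚ_[2] F] (V : NormDiscValuation F) (e : ℤ)
    (he : V.v 2 = (e : WithTop ℤ)) (a b : F) (ha : a ≠ 0) (hb : b ≠ 0)
    (h : ((2 * e : ℤ) : WithTop ℤ) < relDefect V a + relDefect V b) :
    HilbertOne a b := by
  have h20 : (2 : F) ≠ 0 := by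
    rw [← map_ofNat (algebraMap ℚ_[2] F) 2]
    exact (map_ne_zero _).mpr two_ne_zero
  obtain ⟨x, y, hxy⟩ := V.exists_lt_add_of_lt_relDefect_add h
  rw [← V.v_mul] at hxy
  set α := (a - x ^ 2) / a with hα
  set β := (b - y ^ 2) / b with hβ
  have he0 : 0 ≤ e := by
    have := V.v_add 1 1
    rw [V.v_one, min_self, one_add_one_eq_two, he] at this
    exact_mod_cast this
  have hne : 1 - α * β ≠ 0 := by
    intro h0
    rw [← sub_eq_zero.mp h0, V.v_one] at hxy
    norm_cast at hxy
    omega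
  obtain ⟨w, hw⟩ : ∃ w : F, w ^ 2 = 1 - α * β := by
    let : NormedField F := spectralNorm.normedField ℚ_[2] F
    have : CompleteSpace F := spectralNorm.completeSpace ℚ_[2] F
    have : IsUltrametricDist F :=
      IsUltrametricDist.isUltrametricDist_of_isNonarchimedean_norm
        (isNonarchimedean_spectralNorm (K := ℚ_[2]) (L := F))
    have hnorm : ‖(2 : F)‖ < 1 := by
      have h1 : ‖(2 : F)‖ = ‖(2 : ℚ_[2])‖ := by
        rw [← map_ofNat (algebraMap ℚ_[2] F) 2]
        exact spectralNorm_extends _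
      rw [h1]
      exact_mod_cast Padic.norm_p_lt_one (p := 2)
    exact V.exists_sq_eq_one_sub hnorm h20 he hxy
  refine hilbertOne_of_sq_eq h20 ha hb (α := α) (β := β) (x := x) (y := y) ?_ ?_ hw ?_
  · rw [hα]
    field_simp
    ring
  · rw [hβ]
    field_simp
    ring
  · rintro rfl
    apply hne
    rw [← hw]
    simp
end
end

section
/- Let F be a dyadic local field with e = ord(2). Let c ∈ F^× be neither a square nor in ΔF^{×2}, where Δ is a unit with quadratic defect 4𝒪_F. Define c^# as follows: if ord(c) is odd set c^# = Δ; if ord(c) is even, write δ = cπ^{-ord(c)} = s²(1 + rπ^{d(c)}) with units r, s, and set c^# = 1 + 4ρ r^{-1} π^{-d(c)}, where Δ = 1 - 4ρ. Then c^# is a unit of 𝒪_F, d(c^#) = 2e - d(c), and the Hilbert symbol (c^#, c)_𝔭 = -1. -/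
noncomputable section
open scoped Classical

variable {F : Type*}

namespace AddValuation

variable [Field F] (v : AddValuation F (WithTop ℤ))

theorem exists_coe_eq {x : F} (hx : x ≠ 0) : ∃ k : ℤ, v x = k := by
  obtain ⟨k, hk⟩ := WithTop.ne_top_iff_exists.1 ((v.ne_top_iff).2 hx)
  exact ⟨k, hk.symm⟩

variable {v}

theorem ne_zero_of_eq_coe {x : F} {k : ℤ} (h : v x = k) : x ≠ 0 :=
  (v.ne_top_iff).1 (h ▸ WithTop.coe_ne_top)

theorem map_pow_of_eq_coe {x : F} {k : ℤ} (h : v x = k) (n : ℕ) :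
    v (x ^ n) = ((n * k : ℤ) : WithTop ℤ) := by
  rw [map_pow, h, ← WithTop.coe_nsmul, nsmul_eq_mul]

theorem map_inv_of_eq_coe {x : F} {k : ℤ} (h : v x = k) :
    v x⁻¹ = ((-k : ℤ) : WithTop ℤ) := by
  rw [map_inv, h]; rfl

theorem map_zpow_of_eq_coe {x : F} {k : ℤ} (h : v x = k) (n : ℤ) :
    v (x ^ n) = ((n * k : ℤ) : WithTop ℤ) := by
  obtain ⟨m, rfl | rfl⟩ := n.eq_nat_or_neg
  · simpa using map_pow_of_eq_coe h m
  · rw [zpow_neg, zpow_natCast, map_inv_of_eq_coe (map_pow_of_eq_coe h m), neg_mul]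

theorem map_mul_of_eq_coe {x y : F} {k l : ℤ} (hx : v x = k) (hy : v y = l) :
    v (x * y) = ((k + l : ℤ) : WithTop ℤ) := by
  rw [map_mul, hx, hy, WithTop.coe_add]

theorem nonneg_of_isRoot {p : Polynomial F} (hp : p.Monic) (hc : ∀ i, 0 ≤ v (p.coeff i)) {x : F}
    (hx : p.IsRoot x) : 0 ≤ v x := by
  by_contra! h
  have hx0 : x ≠ 0 := by rintro rfl; simp at h
  obtain ⟨k, hk⟩ := v.exists_coe_eq hx0
  have hk0 : k < 0 := by rw [hk] at h; exact_mod_cast h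
  have hsum : x ^ p.natDegree = -∑ i ∈ Finset.range p.natDegree, p.coeff i * x ^ i := by
    have := hx.eq_zero
    rw [Polynomial.eval_eq_sum_range, Finset.sum_range_succ, hp.coeff_natDegree, one_mul] at this
    linear_combination this
  have hlt : v (x ^ p.natDegree) <
      v (∑ i ∈ Finset.range p.natDegree, p.coeff i * x ^ i) := by
    rw [map_pow_of_eq_coe hk]
    refine v.map_lt_sum WithTop.coe_ne_top fun i hi => ?_
    rw [map_mul, map_pow_of_eq_coe hk]
    refine lt_of_lt_of_le (WithTop.coe_lt_coe.2 ?_) (le_add_of_nonneg_left (hc i))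
    have : (i : ℤ) < p.natDegree := by exact_mod_cast Finset.mem_range.1 hi
    nlinarith
  rw [hsum, map_neg] at hlt
  exact lt_irrefl _ hlt

end AddValuation

namespace PadicInt

theorem exists_pow_eq_one_add_two_mul {n : ℕ} (hn : Odd n) (z : ℤ_[2]) :
    ∃ s : ℤ_[2], s ^ n = 1 + 2 * z := by
  have hn1 : ‖(n : ℤ_[2])‖ = 1 := by
    rw [PadicInt.norm_natCast_eq_one_iff]
    exact (Nat.coprime_two_left).2 hn
  have h2 : ‖(2 : ℤ_[2])‖ < 1 := by
    have := PadicInt.norm_p (p := 2)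
    norm_num at this
    rw [this]; norm_num
  obtain ⟨s, hs, -⟩ := hensels_lemma (p := 2) (R := ℤ_[2])
    (F := Polynomial.X ^ n - Polynomial.C (1 + 2 * z)) (a := 1) (by
      simp only [map_sub, map_pow, Polynomial.aeval_X, Polynomial.aeval_C, one_pow,
        Polynomial.derivative_X_pow, Polynomial.derivative_C,
        map_mul, map_natCast, sub_zero, mul_one, hn1]
      simp only [Algebra.algebraMap_self, RingHom.id_apply, sub_add_cancel_left, norm_neg, norm_mul]
      nlinarith [norm_le_one z, norm_nonneg z, norm_nonneg (2 : ℤ_[2])])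
  refine ⟨s, ?_⟩
  simpa [sub_eq_zero] using hs

theorem exists_eq_one_add_two_mul (u : ℤ_[2]ˣ) : ∃ z : ℤ_[2], (u : ℤ_[2]) = 1 + 2 * z := by
  obtain ⟨n, hn, hmem⟩ := exists_mem_range (u : ℤ_[2])
  have hn1 : n = 1 := by
    interval_cases n
    · exact absurd (by simpa only [Nat.cast_zero, sub_zero] using hmem)
        ((IsLocalRing.mem_maximalIdeal _).not.2 (not_not.2 u.isUnit))
    · rfl
  rw [hn1, maximalIdeal_eq_span_p, Ideal.mem_span_singleton] at hmem
  obtain ⟨z, hz⟩ := hmem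
  exact ⟨z, by push_cast at hz; linear_combination hz⟩

end PadicInt

namespace AddValuation

variable [Field F] {v : AddValuation F (WithTop ℤ)}

theorem natCast_nonneg (n : ℕ) : 0 ≤ v (n : F) := by
  induction n with
  | zero => simp
  | succ n ih => push_cast; exact v.map_le_add ih v.map_one.ge

theorem map_algebraMap_padicInt_unit [Algebra ℚ_[2] F] (u : ℤ_[2]ˣ) :
    v (algebraMap ℚ_[2] F (u : ℤ_[2])) = 0 := by
  have hu : algebraMap ℚ_[2] F (u : ℤ_[2]) ≠ 0 := by simp
  obtain ⟨k, hk⟩ := v.exists_coe_eq hu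
  obtain ⟨z, hz⟩ := PadicInt.exists_eq_one_add_two_mul u
  obtain ⟨s, hs⟩ := PadicInt.exists_pow_eq_one_add_two_mul (n := 2 * k.natAbs + 1) ⟨_, rfl⟩ z
  have hsu : algebraMap ℚ_[2] F s ^ (2 * k.natAbs + 1) = algebraMap ℚ_[2] F (u : ℤ_[2]) := by
    rw [hz, ← hs]; simp
  have hs0 : algebraMap ℚ_[2] F s ≠ 0 := fun h => hu (by rw [← hsu, h]; simp)
  obtain ⟨l, hl⟩ := v.exists_coe_eq hs0
  have h := map_pow_of_eq_coe hl (2 * k.natAbs + 1)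
  rw [hsu, hk, WithTop.coe_inj] at h
  have hk0 : k = 0 := by
    apply Int.eq_zero_of_abs_lt_dvd (Dvd.intro _ h.symm)
    rw [Int.abs_eq_natAbs]
    omega
  rw [hk, hk0]; rfl

theorem algebraMap_padicInt_nonneg [Algebra ℚ_[2] F] (z : ℤ_[2]) :
    0 ≤ v (algebraMap ℚ_[2] F z) := by
  rcases eq_or_ne z 0 with rfl | hz
  · simp
  rw [PadicInt.unitCoeff_spec hz]
  rw [PadicInt.coe_mul, _root_.map_mul, map_mul, map_algebraMap_padicInt_unit, zero_add,
    PadicInt.coe_pow, PadicInt.coe_natCast, _root_.map_pow, map_natCast, map_pow]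
  exact nsmul_nonneg (natCast_nonneg 2) _

theorem nonneg_of_spectralNorm_le_one [Algebra ℚ_[2] F] [FiniteDimensional ℚ_[2] F] {x : F}
    (hx : spectralNorm ℚ_[2] F x ≤ 1) : 0 ≤ v x := by
  have hm := minpoly.monic (Algebra.IsIntegral.isIntegral (R := ℚ_[2]) x)
  rw [spectralNorm, spectralValue_le_one_iff hm] at hx
  refine nonneg_of_isRoot (hm.map (algebraMap ℚ_[2] F)) (fun i => ?_) (x := x) ?_
  · rw [Polynomial.coeff_map]
    exact algebraMap_padicInt_nonneg ⟨_, hx i⟩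
  · rw [Polynomial.IsRoot.def, Polynomial.eval_map_algebraMap, minpoly.aeval]

theorem pos_two [Algebra ℚ_[2] F] [FiniteDimensional ℚ_[2] F] {π : F} (hπ : v π = (1 : ℤ)) :
    0 < v (2 : F) := by
  refine lt_of_le_of_ne (natCast_nonneg 2) fun h2 => ?_
  have hQ (q : ℚ_[2]) : 0 ≤ v (algebraMap ℚ_[2] F q) := by
    obtain ⟨z, n, hz⟩ : ∃ (z : ℤ_[2]) (n : ℕ), 2 ^ n * q = z := by
      obtain ⟨n, hn⟩ := pow_unbounded_of_one_lt ‖q‖ one_lt_two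
      have h2 : ‖(2 : ℚ_[2])‖ = 2⁻¹ := by simpa using Padic.norm_p (p := 2)
      refine ⟨⟨2 ^ n * q, ?_⟩, n, rfl⟩
      rw [norm_mul, norm_pow, h2, inv_pow, inv_mul_le_one₀ (by positivity)]
      exact hn.le
    have h := algebraMap_padicInt_nonneg (v := v) z
    rwa [← hz, _root_.map_mul, map_mul, _root_.map_pow, map_ofNat, map_pow, ← h2, nsmul_zero, zero_add] at h
  have hm := minpoly.monic (Algebra.IsIntegral.isIntegral (R := ℚ_[2]) π⁻¹)
  have h : 0 ≤ v π⁻¹ := by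
    refine nonneg_of_isRoot (hm.map (algebraMap ℚ_[2] F)) (fun i => ?_) (x := π⁻¹) ?_
    · rw [Polynomial.coeff_map]
      exact hQ _
    · rw [Polynomial.IsRoot.def, Polynomial.eval_map_algebraMap, minpoly.aeval]
  rw [map_inv_of_eq_coe hπ] at h
  have : (0 : ℤ) ≤ -1 := by exact_mod_cast h
  omega

theorem spectralNorm_le_one_of_nonneg [Algebra ℚ_[2] F] [FiniteDimensional ℚ_[2] F] {π : F}
    (hπ : v π = (1 : ℤ)) {x : F} (hx : 0 ≤ v x) : spectralNorm ℚ_[2] F x ≤ 1 := by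
  let := spectralNorm.normedField ℚ_[2] F
  let := spectralNorm.normedAlgebra ℚ_[2] F
  change ‖x‖ ≤ 1
  by_contra! h
  have h2 : (2 : F) ≠ 0 := by
    rw [← map_ofNat (algebraMap ℚ_[2] F) 2]
    exact (map_ne_zero _).2 two_ne_zero
  obtain ⟨n, hn⟩ := exists_pow_lt_of_lt_one (norm_pos_iff.2 h2) (inv_lt_one_of_one_lt₀ h)
  have hx0 : x ≠ 0 := by rintro rfl; norm_num at h
  have h3 : 0 ≤ v (x⁻¹ ^ n * 2⁻¹) := by
    apply nonneg_of_spectralNorm_le_one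
    change ‖x⁻¹ ^ n * 2⁻¹‖ ≤ 1
    rw [norm_mul, norm_pow, norm_inv, norm_inv]
    rw [← div_eq_mul_inv, div_le_one (norm_pos_iff.2 h2)]
    exact hn.le
  obtain ⟨k, hk⟩ := v.exists_coe_eq hx0
  obtain ⟨l, hl⟩ := v.exists_coe_eq h2
  have h4 := pos_two hπ
  rw [map_mul_of_eq_coe (map_pow_of_eq_coe (map_inv_of_eq_coe hk) n) (map_inv_of_eq_coe hl)] at h3
  rw [hl] at h4
  rw [hk] at hx
  norm_cast at h3 h4 hx
  nlinarith

theorem pos_iff_spectralNorm_lt_one [Algebra ℚ_[2] F] [FiniteDimensional ℚ_[2] F] {π : F}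
    (hπ : v π = (1 : ℤ)) {x : F} : 0 < v x ↔ spectralNorm ℚ_[2] F x < 1 := by
  rcases eq_or_ne x 0 with rfl | hx0
  · simp [spectralNorm_zero]
  have key : v x⁻¹ < 0 ↔ 1 < spectralNorm ℚ_[2] F x⁻¹ := by
    rw [← not_iff_not, not_lt, not_lt]
    exact ⟨spectralNorm_le_one_of_nonneg hπ, nonneg_of_spectralNorm_le_one⟩
  let := spectralNorm.normedField ℚ_[2] F
  have h1 : (1 < spectralNorm ℚ_[2] F x⁻¹) ↔ spectralNorm ℚ_[2] F x < 1 := by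
    change 1 < ‖x⁻¹‖ ↔ ‖x‖ < 1
    rw [norm_inv, one_lt_inv₀ (norm_pos_iff.2 hx0)]
  rw [← h1, ← key]
  obtain ⟨k, hk⟩ := v.exists_coe_eq hx0
  rw [map_inv_of_eq_coe hk, hk]
  norm_cast
  omega

end AddValuation

theorem exists_sq_add_self_eq {K : Type*} [NormedField K] [IsUltrametricDist K] [CompleteSpace K]
    {a : K} (ha : ‖a‖ < 1) : ∃ y : K, y ^ 2 + y = a := by
  let u : ℕ → K := fun n => n.rec 0 fun _ y => a - y ^ 2
  have hu (n) : u (n + 1) = a - u n ^ 2 := rfl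
  have hle (n) : ‖u n‖ ≤ ‖a‖ := by
    induction n with
    | zero => simp [u]
    | succ n ih =>
      rw [hu]
      rw [sub_eq_add_neg]
      refine (IsUltrametricDist.norm_add_le_max _ _).trans (max_le le_rfl ?_)
      rw [norm_neg, norm_pow]
      nlinarith [norm_nonneg (u n)]
  have hdiff (n) : ‖u n - u (n + 1)‖ ≤ 1 * ‖a‖ ^ n := by
    induction n with
    | zero => simpa [u] using ha.le
    | succ n ih =>
      rw [hu, hu (n + 1), show a - u n ^ 2 - (a - u (n + 1) ^ 2) =
        -((u n - u (n + 1)) * (u n + u (n + 1))) by ring, norm_neg, norm_mul, pow_succ, ← mul_assoc]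
      exact mul_le_mul ih ((IsUltrametricDist.norm_add_le_max _ _).trans (max_le (hle n) (hle (n + 1))))
        (norm_nonneg _) (by positivity)
  obtain ⟨y, hy⟩ := cauchySeq_tendsto_of_complete
    (cauchySeq_of_le_geometric ‖a‖ 1 ha fun n => (dist_eq_norm (u n) (u (n + 1))).trans_le (hdiff n))
  refine ⟨y, ?_⟩
  have h1 := hy.comp (Filter.tendsto_add_atTop_nat 1)
  have h2 : Filter.Tendsto (u ∘ fun n => n + 1) Filter.atTop (nhds (a - y ^ 2)) :=
    tendsto_const_nhds.sub (hy.pow 2)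
  linear_combination tendsto_nhds_unique h1 h2

theorem exists_finite_forall_norm_sub_lt_one (K : Type*) [NormedField K] [ProperSpace K] :
    ∃ T : Set K, T.Finite ∧ ∀ x : K, ‖x‖ ≤ 1 → ∃ t ∈ T, ‖x - t‖ < 1 := by
  obtain ⟨T, -, hT, h⟩ := (isCompact_closedBall (0 : K) 1).finite_cover_balls one_pos
  refine ⟨T, hT, fun x hx => ?_⟩
  simpa [dist_eq_norm] using h (mem_closedBall_zero_iff.2 hx)

namespace AddValuation

variable [Field F] [Algebra ℚ_[2] F] [FiniteDimensional ℚ_[2] F] {v : AddValuation F (WithTop ℤ)}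
  {π : F}

theorem exists_sq_add_self_eq_of_pos (hπ : v π = (1 : ℤ)) {a : F} (ha : 0 < v a) :
    ∃ y : F, y ^ 2 + y = a := by
  let := spectralNorm.normedField ℚ_[2] F
  have : IsUltrametricDist F :=
    IsUltrametricDist.isUltrametricDist_of_isNonarchimedean_norm isNonarchimedean_spectralNorm
  exact exists_sq_add_self_eq ((pos_iff_spectralNorm_lt_one hπ).1 ha)

theorem exists_finite_forall_pos_sub (hπ : v π = (1 : ℤ)) :
    ∃ T : Set F, T.Finite ∧ ∀ x : F, 0 ≤ v x → ∃ t ∈ T, 0 < v (x - t) := by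
  let := spectralNorm.normedField ℚ_[2] F
  let := spectralNorm.normedAlgebra ℚ_[2] F
  have : ProperSpace F := FiniteDimensional.proper ℚ_[2] F
  obtain ⟨T, hT, h⟩ := exists_finite_forall_norm_sub_lt_one F
  refine ⟨T, hT, fun x hx => ?_⟩
  obtain ⟨t, ht, hxt⟩ := h x (spectralNorm_le_one_of_nonneg hπ hx)
  exact ⟨t, ht, (pos_iff_spectralNorm_lt_one hπ).2 hxt⟩

end AddValuation

namespace FiniteField

variable {k : Type*} [Field k] [Finite k] [CharP k 2]

theorem exists_sq_add_self_eq_or {r : k} (hr : ∀ y, y ^ 2 + y ≠ r) (u : k) :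
    ∃ y, y ^ 2 + y = u ∨ y ^ 2 + y = u + r := by
  let f : k →+ k := AddMonoidHom.mk' (fun y => y ^ 2 + y) fun a b => by
    rw [CharTwo.add_sq]; ring
  have hf (y) : f y = y ^ 2 + y := rfl
  have hker : Nat.card f.ker = 2 := by
    have : (f.ker : Set k) = {0, 1} := by
      ext y
      simp only [SetLike.mem_coe, AddMonoidHom.mem_ker, hf, Set.mem_insert_iff,
        Set.mem_singleton_iff]
      rw [show y ^ 2 + y = y * (y + 1) by ring, mul_eq_zero, CharTwo.add_eq_zero]
    rw [← SetLike.coe_sort_coe, this, Nat.card_coe_set_eq, Set.ncard_pair zero_ne_one]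
  have hindex : f.range.index = 2 := by
    have h1 := f.range.card_mul_index
    have h2 := f.ker.card_mul_index
    rw [AddSubgroup.index_ker, hker, mul_comm] at h2
    exact Nat.eq_of_mul_eq_mul_left Nat.card_pos (h1.trans h2.symm)
  have h := AddSubgroup.add_mem_iff_of_index_two hindex (a := u) (b := r)
  have hr' : r ∉ f.range := fun ⟨y, hy⟩ => hr y hy
  by_cases hu : u ∈ f.range
  · obtain ⟨y, hy⟩ := hu
    exact ⟨y, Or.inl hy⟩
  · obtain ⟨y, hy⟩ := h.2 (iff_of_false hu hr')
    exact ⟨y, Or.inr hy⟩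

end FiniteField

namespace AddValuation

variable [Field F] (v : AddValuation F (WithTop ℤ))

/-- The ring of elements of nonnegative valuation. -/
abbrev integerRing : ValuationSubring F := (toValuation v).valuationSubring

variable {v}

theorem residue_eq_zero_iff {x : integerRing v} :
    IsLocalRing.residue (integerRing v) x = 0 ↔ 0 < v (x : F) := by
  have hx : 0 ≤ v (x : F) := x.2
  rw [IsLocalRing.residue_eq_zero_iff, IsLocalRing.mem_maximalIdeal, mem_nonunits_iff,
    ← not_iff_not, not_not, not_lt]
  constructor
  · rintro ⟨u, rfl⟩
    have h : v ((u : integerRing v) : F) + v ((u⁻¹ : (integerRing v)ˣ) : integerRing v) = 0 := by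
      rw [← map_mul, ← MulMemClass.coe_mul, u.mul_inv]; exact v.map_one
    have h' : 0 ≤ v ((u⁻¹ : (integerRing v)ˣ) : integerRing v) := (u⁻¹ : (integerRing v)ˣ).1.2
    rw [← h]
    exact le_add_of_nonneg_right h'
  · intro h
    have h0 : v (x : F) = ((0 : ℤ) : WithTop ℤ) := le_antisymm h hx
    have hinv : 0 ≤ v (x : F)⁻¹ := by rw [map_inv_of_eq_coe h0]; rfl
    exact IsUnit.of_mul_eq_one ⟨(x : F)⁻¹, hinv⟩
      (Subtype.ext (mul_inv_cancel₀ (ne_zero_of_eq_coe h0)))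

theorem finite_residueField {T : Set F} (hT : T.Finite)
    (h : ∀ x : F, 0 ≤ v x → ∃ t ∈ T, 0 < v (x - t)) :
    Finite (IsLocalRing.ResidueField (integerRing v)) := by
  have := hT.to_subtype
  have hr := IsLocalRing.residue_surjective (R := integerRing v)
  choose g hg using hr
  choose t ht hlt using fun x : integerRing v => h x x.2
  refine Finite.of_injective (fun a => (⟨t (g a), ht _⟩ : T)) fun a b hab => ?_
  rw [← hg a, ← hg b, ← sub_eq_zero, ← _root_.map_sub, residue_eq_zero_iff]
  have h1 := hlt (g a)
  rw [show t (g a) = t (g b) from congrArg Subtype.val hab] at h1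
  have h2 := v.map_sub (g a - t (g b)) (g b - t (g b))
  rw [sub_sub_sub_cancel_right] at h2
  exact (lt_min h1 (hlt (g b))).trans_le h2

theorem charP_residueField (h2 : 0 < v (2 : F)) :
    CharP (IsLocalRing.ResidueField (integerRing v)) 2 := by
  refine CharTwo.of_one_ne_zero_of_two_eq_zero one_ne_zero ?_
  rw [← map_ofNat (IsLocalRing.residue (integerRing v)) 2, residue_eq_zero_iff]
  exact h2

theorem exists_pos_sub_sq [Finite (IsLocalRing.ResidueField (integerRing v))]
    (h2 : 0 < v (2 : F)) {u : F} (hu : 0 ≤ v u) : ∃ t : F, 0 ≤ v t ∧ 0 < v (u - t ^ 2) := by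
  have := charP_residueField h2
  obtain ⟨s, hs⟩ := isSquare_of_charTwo' (IsLocalRing.residue (integerRing v) ⟨u, hu⟩)
  obtain ⟨t, rfl⟩ := IsLocalRing.residue_surjective s
  refine ⟨t, t.2, ?_⟩
  rw [← sub_eq_zero, ← _root_.map_mul, ← _root_.map_sub, residue_eq_zero_iff] at hs
  rw [pow_two]
  exact hs

theorem exists_pos_sub_or_pos_add_sub [Finite (IsLocalRing.ResidueField (integerRing v))]
    (h2 : 0 < v (2 : F)) {r : F} (hr : 0 ≤ v r) (hno : ∀ y, 0 ≤ v y → ¬ 0 < v (y ^ 2 + y - r))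
    {u : F} (hu : 0 ≤ v u) :
    ∃ y : F, 0 ≤ v y ∧ (0 < v (y ^ 2 + y - u) ∨ 0 < v (y ^ 2 + y - (u + r))) := by
  have := charP_residueField h2
  obtain ⟨y, hy⟩ := FiniteField.exists_sq_add_self_eq_or
    (r := IsLocalRing.residue (integerRing v) ⟨r, hr⟩) (fun y hy => by
      obtain ⟨y, rfl⟩ := IsLocalRing.residue_surjective y
      refine hno y y.2 ?_
      rw [← sub_eq_zero, ← _root_.map_pow, ← _root_.map_add, ← _root_.map_sub,
        residue_eq_zero_iff] at hy
      exact hy) (IsLocalRing.residue (integerRing v) ⟨u, hu⟩)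
  obtain ⟨y, rfl⟩ := IsLocalRing.residue_surjective y
  refine ⟨y, y.2, hy.imp (fun h => ?_) fun h => ?_⟩
  · rw [← sub_eq_zero, ← _root_.map_pow, ← _root_.map_add, ← _root_.map_sub,
      residue_eq_zero_iff] at h
    exact h
  · rw [← sub_eq_zero, ← _root_.map_pow, ← _root_.map_add, ← _root_.map_add, ← _root_.map_sub,
      residue_eq_zero_iff] at h
    exact h

end AddValuation

section QuadraticNorm

variable [Field F]

/-- `b` is represented by the norm form `p² - a q²`. -/
def IsQuadraticNorm (a b : F) : Prop := ∃ p q : F, b = p ^ 2 - a * q ^ 2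

namespace IsQuadraticNorm

variable {a b b' : F}

theorem mul (h : IsQuadraticNorm a b) (h' : IsQuadraticNorm a b') :
    IsQuadraticNorm a (b * b') := by
  obtain ⟨p, q, rfl⟩ := h
  obtain ⟨p', q', rfl⟩ := h'
  exact ⟨p * p' + a * q * q', p * q' + q * p', by ring⟩

theorem of_mul_sq {t : F} (ht : t ≠ 0) (h : IsQuadraticNorm a (b * t ^ 2)) :
    IsQuadraticNorm a b := by
  obtain ⟨p, q, h⟩ := h
  exact ⟨p / t, q / t, by field_simp; exact h⟩

theorem neg_self (a : F) : IsQuadraticNorm a (-a) := ⟨0, 1, by ring⟩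

theorem of_sq (h2 : (2 : F) ≠ 0) {s : F} (hs : s ≠ 0) (b : F) : IsQuadraticNorm (s ^ 2) b :=
  ⟨(b + 1) / 2, (b - 1) / (2 * s), by field_simp; ring⟩

theorem symm (h2 : (2 : F) ≠ 0) (hb : b ≠ 0) (h : IsQuadraticNorm a b) :
    IsQuadraticNorm b a := by
  obtain ⟨p, q, h⟩ := h
  rcases eq_or_ne q 0 with rfl | hq
  · obtain rfl : b = p ^ 2 := by linear_combination h
    exact of_sq h2 (fun hp => hb (by simp [hp])) a
  · exact ⟨p / q, 1 / q, by field_simp; linear_combination h⟩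

theorem of_hilbertOne (h2 : (2 : F) ≠ 0) (h : HilbertOne a b) : IsQuadraticNorm a b := by
  obtain ⟨x, y, h⟩ := h
  rcases eq_or_ne y 0 with rfl | hy
  · have hx : x ≠ 0 := by rintro rfl; simp at h
    obtain rfl : a = (1 / x) ^ 2 := by field_simp; linear_combination h
    exact of_sq h2 (one_div_ne_zero hx) b
  · exact ⟨1 / y, x / y, by field_simp; linear_combination h⟩

/-- The Hilbert symbol identity `(1 + a, 1 + b) = (1 - ab, a(1 + a)(1 + b))`, in one direction. -/
theorem one_sub_mul (h2 : (2 : F) ≠ 0) (ha : a ≠ 0) (hA : 1 + a ≠ 0) (hB : 1 + b ≠ 0)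
    (hD : 1 - a * b ≠ 0) (h : IsQuadraticNorm (1 + b) (1 + a)) :
    IsQuadraticNorm (1 - a * b) (a * (1 + a) * (1 + b)) := by
  have hN : a * (1 + a) * (1 + b) ≠ 0 := mul_ne_zero (mul_ne_zero ha hA) hB
  have h1 : IsQuadraticNorm (1 + a) (a * (1 + a) * (1 + b)) := by
    have hna : IsQuadraticNorm (1 + a) (-a) := ⟨1, 1, by ring⟩
    have := ((h.symm h2 hA).mul hna).mul (neg_self (1 + a))
    rwa [show (1 + b) * -a * -(1 + a) = a * (1 + a) * (1 + b) by ring] at this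
  have h3 : IsQuadraticNorm ((1 + a) * (1 - a * b)) (a * (1 + a) * (1 + b)) := by
    have : IsQuadraticNorm ((1 + a) * (1 - a * b)) (-a * (1 + b) * (1 - a * b)) :=
      ⟨1 - a * b, 1, by ring⟩
    refine of_mul_sq hD ?_
    have := this.mul (neg_self _)
    rwa [show -a * (1 + b) * (1 - a * b) * -((1 + a) * (1 - a * b)) =
      a * (1 + a) * (1 + b) * (1 - a * b) ^ 2 by ring] at this
  refine symm h2 hD (of_mul_sq hA ?_)
  have := (h1.symm h2 hN).mul (h3.symm h2 hN)
  rwa [show (1 + a) * ((1 + a) * (1 - a * b)) = (1 - a * b) * (1 + a) ^ 2 by ring] at this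

end IsQuadraticNorm

end QuadraticNorm

namespace AddValuation

variable [Field F] {v : AddValuation F (WithTop ℤ)}

theorem coe_add_lt_map_mul {x y : F} {k l : ℤ} (hx : v x = k) (hy : (l : WithTop ℤ) < v y) :
    ((k + l : ℤ) : WithTop ℤ) < v (x * y) := by
  rw [map_mul, hx, WithTop.coe_add]
  exact WithTop.add_lt_add_left WithTop.coe_ne_top hy

theorem coe_add_le_map_mul {x y : F} {k l : ℤ} (hx : v x = k) (hy : (l : WithTop ℤ) ≤ v y) :
    ((k + l : ℤ) : WithTop ℤ) ≤ v (x * y) := by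
  rw [map_mul, hx, WithTop.coe_add]
  gcongr

theorem map_sq_sub_one {e : ℤ} (h2 : v (2 : F) = e) (w : F) :
    (∃ k < e, v (w ^ 2 - 1) = ((2 * k : ℤ) : WithTop ℤ)) ∨
      ((2 * e : ℤ) : WithTop ℤ) ≤ v (w ^ 2 - 1) := by
  have hw : w ^ 2 - 1 = (w - 1) * (w - 1 + 2) := by ring
  rcases lt_or_ge (v (w - 1)) e with h | h
  · obtain ⟨k, hk⟩ := v.exists_coe_eq ((v.ne_top_iff).1 h.ne_top)
    refine Or.inl ⟨k, by rw [hk] at h; exact_mod_cast h, ?_⟩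
    have h' : v (w - 1 + 2) = k := by
      rw [v.map_add_eq_of_lt_left (h.trans_eq h2.symm), hk]
    rw [hw, map_mul_of_eq_coe hk h', two_mul]
  · right
    rw [hw, map_mul, two_mul, WithTop.coe_add]
    exact add_le_add h (v.map_le_add h h2.ge)

theorem map_one_add_of_pos {x : F} (hx : 0 < v x) : v (1 + x) = ((0 : ℤ) : WithTop ℤ) := by
  rw [v.map_add_eq_of_lt_left (by rwa [v.map_one]), v.map_one]; rfl

/-- If `v (Δ - w²) ≤ 2e` for all `w`, the nonzero values of `p² - Δ q²` have even order. -/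
theorem even_of_map_eq_sq_sub {e : ℤ} (h2 : v (2 : F) = e) {ρ Δ : F} (hρ : v ρ = (0 : ℤ))
    (hΔ : Δ = 1 - 4 * ρ) (hΔd : ∀ w, v (Δ - w ^ 2) ≤ ((2 * e : ℤ) : WithTop ℤ)) {b : F} {k : ℤ}
    (hb : v b = k) (h : IsQuadraticNorm Δ b) : Even k := by
  have h4 : v (4 * ρ) = ((2 * e : ℤ) : WithTop ℤ) := by
    have := map_mul_of_eq_coe (map_pow_of_eq_coe h2 2) hρ
    norm_num at this ⊢
    exact this
  obtain ⟨p, q, rfl⟩ := h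
  rcases eq_or_ne q 0 with rfl | hq
  · have hp : p ≠ 0 := fun hp => ne_zero_of_eq_coe hb (by simp [hp])
    obtain ⟨l, hl⟩ := v.exists_coe_eq hp
    have h := map_pow_of_eq_coe hl 2
    rw [show p ^ 2 = p ^ 2 - Δ * 0 ^ 2 by ring, hb, WithTop.coe_inj] at h
    exact ⟨l, by push_cast at h; omega⟩
  · obtain ⟨l, hl⟩ := v.exists_coe_eq hq
    have hw : p ^ 2 - Δ * q ^ 2 = -(q ^ 2 * (Δ - (p / q) ^ 2)) := by field_simp; ring
    obtain ⟨j, hj⟩ : ∃ j : ℤ, v (Δ - (p / q) ^ 2) = ((2 * j : ℤ) : WithTop ℤ) := by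
      have hs : Δ - (p / q) ^ 2 = -(((p / q) ^ 2 - 1) + 4 * ρ) := by rw [hΔ]; ring
      rcases map_sq_sub_one h2 (p / q) with ⟨j, hj, h⟩ | h
      · refine ⟨j, ?_⟩
        rw [hs, map_neg, v.map_add_eq_of_lt_left, h]
        rw [h, h4, WithTop.coe_lt_coe]
        omega
      · refine ⟨e, le_antisymm (hΔd _) ?_⟩
        rw [hs, map_neg]
        exact v.map_le_add h h4.ge
    rw [hw, map_neg, map_mul_of_eq_coe (map_pow_of_eq_coe hl 2) hj, WithTop.coe_inj] at hb
    exact ⟨l + j, by push_cast at hb; omega⟩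

end AddValuation

namespace NormDiscValuation

variable [Field F]

/-- The valuation, as a bundled `AddValuation`. -/
def toAddValuation (V : NormDiscValuation F) : AddValuation F (WithTop ℤ) :=
  AddValuation.of V.v V.v_zero
    (by
      have h := V.v_mul 1 1
      obtain ⟨k, hk⟩ := WithTop.ne_top_iff_exists.1 (V.v_ne_top 1 one_ne_zero)
      rw [mul_one, ← hk, ← WithTop.coe_add, WithTop.coe_inj] at h
      rw [← hk, show k = 0 by omega]
      rfl)
    V.v_add V.v_mul

variable {V : NormDiscValuation F}

theorem isLUB_relDefect (V : NormDiscValuation F) (c : F) :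
    IsLUB (Set.range fun x : F => V.toAddValuation ((c - x ^ 2) / c)) (relDefect V c) :=
  WithTop.isLUB_sSup' (Set.range_nonempty _)

theorem relDefect_eq_of_forall_le {c : F} {n : WithTop ℤ} (x : F)
    (hx : V.toAddValuation ((c - x ^ 2) / c) = n)
    (h : ∀ x : F, V.toAddValuation ((c - x ^ 2) / c) ≤ n) : relDefect V c = n :=
  (V.isLUB_relDefect c).unique (IsGreatest.isLUB ⟨⟨x, hx⟩, Set.forall_mem_range.2 h⟩)

theorem map_div_of_map_eq_zero {a : F} (ha : V.toAddValuation a = (0 : ℤ)) (x : F) :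
    V.toAddValuation (x / a) = V.toAddValuation x := by
  rw [div_eq_mul_inv, AddValuation.map_mul, AddValuation.map_inv_of_eq_coe ha, neg_zero]
  exact add_zero _

theorem map_sub_sq_le_relDefect {a t : F} (ha : V.toAddValuation a = (0 : ℤ)) (ht : t ≠ 0) (w : F) :
    V.toAddValuation (a - w ^ 2) ≤ relDefect V (a * t ^ 2) := by
  rw [← map_div_of_map_eq_zero ha]
  refine (V.isLUB_relDefect _).1 ⟨w * t, ?_⟩
  have ha0 := AddValuation.ne_zero_of_eq_coe ha
  exact congrArg _ (by field_simp)

theorem relDefect_eq_zero_of_odd {c : F} {m : ℤ} (hc : V.toAddValuation c = m) (hm : Odd m) :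
    relDefect V c = ((0 : ℤ) : WithTop ℤ) := by
  have hc0 := AddValuation.ne_zero_of_eq_coe hc
  refine relDefect_eq_of_forall_le 0 (by simp [hc0]) fun x => ?_
  have key : V.toAddValuation (c - x ^ 2) ≤ m := by
    rcases eq_or_ne x 0 with rfl | hx
    · simp [hc]
    obtain ⟨l, hl⟩ := V.toAddValuation.exists_coe_eq hx
    have hl2 := AddValuation.map_pow_of_eq_coe hl 2
    have hne : V.toAddValuation c ≠ V.toAddValuation (-x ^ 2) := by
      rw [AddValuation.map_neg, hc, hl2, Ne, WithTop.coe_inj]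
      rintro rfl
      exact Int.not_even_iff_odd.2 hm ⟨l, by push_cast; ring⟩
    rw [sub_eq_add_neg, AddValuation.map_add_of_distinct_val _ hne, ← hc]
    exact min_le_left _ _
  have h := AddValuation.map_inv_of_eq_coe hc
  rw [div_eq_mul_inv, AddValuation.map_mul, h]
  exact (add_le_add key le_rfl).trans_eq (by rw [← WithTop.coe_add, add_neg_cancel])

/-- The defect of `1 + b` is `ord b` when this order is odd and strictly between `0` and `2e`. -/
theorem relDefect_one_add {e k : ℤ} (h2 : V.toAddValuation 2 = e) {b : F}
    (hb : V.toAddValuation b = k) (hk : Odd k) (h0 : 0 < k) (hke : k < 2 * e) :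
    relDefect V (1 + b) = k := by
  have hB : V.toAddValuation (1 + b) = (0 : ℤ) :=
    AddValuation.map_one_add_of_pos (by rw [hb]; exact_mod_cast h0)
  refine relDefect_eq_of_forall_le 1 ?_ fun w => ?_
  · rw [map_div_of_map_eq_zero hB, one_pow, add_sub_cancel_left, hb]
  · rw [map_div_of_map_eq_zero hB, show 1 + b - w ^ 2 = b + -(w ^ 2 - 1) by ring]
    rw [AddValuation.map_add_of_distinct_val, ← hb]
    · exact min_le_left _ _
    rw [AddValuation.map_neg, hb]
    rcases AddValuation.map_sq_sub_one h2 w with ⟨j, -, h⟩ | h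
    · rw [h, Ne, WithTop.coe_inj]
      rintro rfl
      exact Int.not_even_iff_odd.2 hk (even_two_mul j)
    · exact ((WithTop.coe_lt_coe.2 hke).trans_le h).ne

end NormDiscValuation

namespace AddValuation

variable [Field F] {v : AddValuation F (WithTop ℤ)}

theorem not_pos_sq_add_self_sub {e : ℤ} (h2 : v (2 : F) = e) {ρ : F}
    (hΔd : ∀ w, v (1 - 4 * ρ - w ^ 2) ≤ ((2 * e : ℤ) : WithTop ℤ)) (hρ : 0 ≤ v ρ)
    (he : 0 < e) (y : F) : ¬ 0 < v (y ^ 2 + y - ρ) := by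
  intro h
  have h4 : v (2 ^ 2 : F) = ((2 * e : ℤ) : WithTop ℤ) := map_pow_of_eq_coe h2 2
  refine (hΔd (1 + 2 * y)).not_gt ?_
  rw [show 1 - 4 * ρ - (1 + 2 * y) ^ 2 = -(2 ^ 2 * (y ^ 2 + y - ρ + 2 * ρ)) by ring, map_neg]
  have h2ρ : 0 < v (2 * ρ) := by
    rw [map_mul, h2]
    exact add_pos_of_pos_of_nonneg (by exact_mod_cast he) hρ
  simpa using coe_add_lt_map_mul (l := 0) h4 (v.map_lt_add h h2ρ)

/-- If `v (1 + a - w²) ≤ ord a` for all `w`, and `1 + a` is neither a square nor `Δ` times a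
square, then `ord a` is odd and strictly between `0` and `2e`. -/
theorem odd_and_pos_and_lt [Algebra ℚ_[2] F] [FiniteDimensional ℚ_[2] F] {e d : ℤ} {π ρ a : F}
    (h2 : v (2 : F) = e) (hπ : v π = (1 : ℤ)) (hρ : v ρ = (0 : ℤ))
    (hΔd : ∀ w, v (1 - 4 * ρ - w ^ 2) ≤ ((2 * e : ℤ) : WithTop ℤ))
    (ha : v a = d) (hA : v (1 + a) = (0 : ℤ)) (had : ∀ w, v (1 + a - w ^ 2) ≤ d)
    (hsq : ∀ t, 1 + a ≠ t ^ 2) (hΔsq : ∀ t, 1 + a ≠ (1 - 4 * ρ) * t ^ 2) (hd : 0 ≤ d) :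
    Odd d ∧ 0 < d ∧ d < 2 * e := by
  have hpos2 : 0 < v (2 : F) := pos_two hπ
  have he : 0 < e := by rw [h2] at hpos2; exact_mod_cast hpos2
  have h20 : (2 : F) ≠ 0 := ne_zero_of_eq_coe h2
  have hπ0 : π ≠ 0 := ne_zero_of_eq_coe hπ
  have h4 : v (2 ^ 2 : F) = ((2 * e : ℤ) : WithTop ℤ) := map_pow_of_eq_coe h2 2
  obtain ⟨T, hT, hTx⟩ := exists_finite_forall_pos_sub hπ
  have := finite_residueField hT hTx
  have hd0 : d ≠ 0 := by
    rintro rfl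
    obtain ⟨t, -, ht⟩ := exists_pos_sub_sq hpos2 hA.ge
    exact (had t).not_gt ht
  have hdpos : 0 < d := by omega
  have hroot {η : F} (hη : 0 < v η) : ∃ z, 1 + 2 ^ 2 * η = (1 + 2 * z) ^ 2 := by
    obtain ⟨z, hz⟩ := exists_sq_add_self_eq_of_pos hπ hη
    exact ⟨z, by rw [← hz]; ring⟩
  have hinv4 : v ((2 ^ 2)⁻¹ : F) = ((-(2 * e) : ℤ) : WithTop ℤ) := map_inv_of_eq_coe h4
  have ha4 : a = 2 ^ 2 * (a * (2 ^ 2)⁻¹) := by field_simp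
  have hu := map_mul_of_eq_coe ha hinv4
  set u := a * (2 ^ 2)⁻¹ with hudef
  have hle : d ≤ 2 * e := by
    by_contra! hlt
    obtain ⟨z, hz⟩ := hroot (η := u) (by rw [hu]; exact_mod_cast (by omega : 0 < d + -(2 * e)))
    exact hsq _ (ha4 ▸ hz)
  have hne : d ≠ 2 * e := by
    intro hde
    have hu0 : 0 ≤ v u := by rw [hu]; exact_mod_cast (by omega : 0 ≤ d + -(2 * e))
    obtain ⟨y, hy, h | h⟩ := exists_pos_sub_or_pos_add_sub hpos2 hρ.ge
      (fun y _ => not_pos_sq_add_self_sub h2 hΔd hρ.ge he y) hu0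
    · refine (had (1 + 2 * y)).not_gt ?_
      rw [show 1 + a - (1 + 2 * y) ^ 2 = -(2 ^ 2 * (y ^ 2 + y - u)) by rw [ha4]; ring, map_neg,
        hde]
      simpa using coe_add_lt_map_mul (l := 0) h4 h
    · set ε := y ^ 2 + y - (u + ρ) with hε
      have hunit {x : F} (hx : 0 ≤ v x) : v (1 + 2 * x) = (0 : ℤ) :=
        map_one_add_of_pos (by rw [map_mul]; exact add_pos_of_pos_of_nonneg hpos2 hx)
      have hΔ : v (1 - 4 * ρ) = (0 : ℤ) := by
        have : v (1 + 2 * (-2 * ρ)) = (0 : ℤ) := hunit (by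
          rw [map_mul, map_neg]; exact add_nonneg hpos2.le hρ.ge)
        rwa [show 1 + 2 * (-2 * ρ) = 1 - 4 * ρ by ring] at this
      have hden := map_mul_of_eq_coe hΔ (map_pow_of_eq_coe (hunit hy) 2)
      have hden0 := ne_zero_of_eq_coe hden
      have hnum : 0 < v (-ε + 2 ^ 2 * (ρ * (y ^ 2 + y))) := by
        refine v.map_lt_add (by rwa [map_neg]) ?_
        rw [map_mul, h4]
        refine add_pos_of_pos_of_nonneg (by exact_mod_cast (by omega : 0 < 2 * e)) ?_
        rw [map_mul]
        refine add_nonneg hρ.ge (v.map_le_add ?_ hy)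
        rw [map_pow]
        exact nsmul_nonneg hy 2
      obtain ⟨z, hz⟩ := hroot (η := (-ε + 2 ^ 2 * (ρ * (y ^ 2 + y))) /
        ((1 - 4 * ρ) * (1 + 2 * y) ^ 2)) (by
          rw [div_eq_mul_inv, map_mul, map_inv_of_eq_coe hden]
          simpa using hnum)
      refine hΔsq ((1 + 2 * y) * (1 + 2 * z)) ?_
      rw [mul_pow, ← hz, ← mul_assoc, mul_add, mul_one, mul_left_comm, mul_div_cancel₀ _ hden0, ha4,
        hε]
      ring
  refine ⟨?_, hdpos, by omega⟩
  by_contra hodd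
  obtain ⟨j, hj⟩ := Int.not_odd_iff_even.1 hodd
  have hr := map_mul_of_eq_coe ha (map_zpow_of_eq_coe hπ (-d))
  obtain ⟨t, ht, hrt⟩ := exists_pos_sub_sq hpos2 (u := a * π ^ (-d))
    (by rw [hr]; exact_mod_cast (by omega : 0 ≤ d + -d * 1))
  refine (had (1 + t * π ^ j)).not_gt ?_
  have hπd : π ^ d = π ^ j * π ^ j := by rw [← zpow_add₀ hπ0, hj]
  have heq : 1 + a - (1 + t * π ^ j) ^ 2 = π ^ d * (a * π ^ (-d) - t ^ 2) - 2 * π ^ j * t := by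
    have : π ^ d * π ^ (-d) = 1 := by rw [← zpow_add₀ hπ0]; simp
    linear_combination (-a) * this + t ^ 2 * hπd
  rw [heq, sub_eq_add_neg]
  refine v.map_lt_add ?_ ?_
  · simpa using coe_add_lt_map_mul (l := 0) (map_zpow_of_eq_coe hπ d) hrt
  · rw [map_neg]
    refine lt_of_lt_of_le ?_ (coe_add_le_map_mul (l := 0)
      (map_mul_of_eq_coe h2 (map_zpow_of_eq_coe hπ j)) ht)
    exact_mod_cast (by omega : d < e + j * 1 + 0)

end AddValuation

/-- basic properties of `c^#`.  Here `c` is neither a square nor in `ΔF^{×2}`,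
`m = ord c`, `dc = d(c)`, and `csharp` is defined as `Δ` when `m` is odd, and as
`1 + 4ρ r⁻¹ π^{-d(c)}` coming from an expression `c π^{-ord c} = s²(1 + r π^{d(c)})`
with units `r, s` when `m` is even.  Conclusion: `c^#` is a unit, `d(c^#) = 2e - d(c)` and
`(c^#, c)_𝔭 = -1`. -/
theorem csharp_properties [Field F] [Algebra ℚ_[2] F] [FiniteDimensional ℚ_[2] F]
    (V : NormDiscValuation F) (e : ℤ) (he : V.v 2 = (e : WithTop ℤ))
    (π ρ Δ : F) (hπ : V.v π = ((1 : ℤ) : WithTop ℤ)) (hρ : V.v ρ = (0 : WithTop ℤ))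
    (hΔ : Δ = 1 - 4 * ρ) (hΔd : relDefect V Δ = ((2 * e : ℤ) : WithTop ℤ))
    (c : F) (hc0 : c ≠ 0) (hcsq : ¬ IsSquare c) (hcΔ : ¬ ∃ t : F, c = Δ * t ^ 2)
    (m dc : ℤ) (hm : V.v c = (m : WithTop ℤ)) (hdc : relDefect V c = (dc : WithTop ℤ))
    (csharp : F)
    (hodd : Odd m → csharp = Δ)
    (heven : Even m → ∃ r s : F, V.v r = (0 : WithTop ℤ) ∧ V.v s = (0 : WithTop ℤ) ∧
      c * π ^ (-m) = s ^ 2 * (1 + r * π ^ dc) ∧ csharp = 1 + 4 * ρ * r⁻¹ * π ^ (-dc)) :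
    V.v csharp = (0 : WithTop ℤ) ∧
      relDefect V csharp = ((2 * e - dc : ℤ) : WithTop ℤ) ∧
      ¬ HilbertOne csharp c := by
  change V.toAddValuation 2 = _ at he
  change V.toAddValuation π = _ at hπ
  change V.toAddValuation ρ = _ at hρ
  change V.toAddValuation c = _ at hm
  change V.toAddValuation csharp = _ ∧ _
  have h20 : (2 : F) ≠ 0 := AddValuation.ne_zero_of_eq_coe he
  have hπ0 : π ≠ 0 := AddValuation.ne_zero_of_eq_coe hπ
  have hρ0 : ρ ≠ 0 := AddValuation.ne_zero_of_eq_coe (k := 0) hρ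
  have he0 : 0 < e := by
    have h := AddValuation.pos_two hπ
    rw [he] at h
    exact_mod_cast h
  have h4ρ : V.toAddValuation (4 * ρ) = ((2 * e : ℤ) : WithTop ℤ) := by
    have h := AddValuation.map_mul_of_eq_coe (AddValuation.map_pow_of_eq_coe he 2)
      (show V.toAddValuation ρ = (0 : ℤ) from hρ)
    norm_num at h ⊢
    exact h
  have hΔ0 : V.toAddValuation Δ = (0 : ℤ) := by
    rw [hΔ, sub_eq_add_neg]
    refine AddValuation.map_one_add_of_pos ?_
    rw [AddValuation.map_neg, h4ρ]
    exact_mod_cast (by omega : 0 < 2 * e)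
  have hΔle (w : F) : V.toAddValuation (Δ - w ^ 2) ≤ ((2 * e : ℤ) : WithTop ℤ) := by
    have h := NormDiscValuation.map_sub_sq_le_relDefect hΔ0 one_ne_zero w
    rwa [one_pow, mul_one, hΔd] at h
  have hnorm {b : F} {k : ℤ} (hb : V.toAddValuation b = k) (h : IsQuadraticNorm Δ b) : Even k :=
    AddValuation.even_of_map_eq_sq_sub he hρ hΔ hΔle hb h
  rcases Int.even_or_odd m with hev | hod
  · obtain ⟨r, s, hr, hs, hcs, rfl⟩ := heven hev
    obtain ⟨j, hj⟩ := hev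
    have hr' : V.toAddValuation r = (0 : ℤ) := hr
    have hs' : V.toAddValuation s = (0 : ℤ) := hs
    have hr0 : r ≠ 0 := AddValuation.ne_zero_of_eq_coe hr'
    have hs0 : s ≠ 0 := AddValuation.ne_zero_of_eq_coe hs'
    set a := r * π ^ dc with ha_def
    set b := 4 * ρ * r⁻¹ * π ^ (-dc) with hb_def
    have ha : V.toAddValuation a = dc := by
      have h := AddValuation.map_mul_of_eq_coe hr' (AddValuation.map_zpow_of_eq_coe hπ dc)
      rwa [zero_add, mul_one] at h
    have hb : V.toAddValuation b = ((2 * e - dc : ℤ) : WithTop ℤ) := by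
      have h := AddValuation.map_mul_of_eq_coe (AddValuation.map_mul_of_eq_coe h4ρ
        (AddValuation.map_inv_of_eq_coe hr')) (AddValuation.map_zpow_of_eq_coe hπ (-dc))
      rwa [neg_zero, add_zero, mul_one, ← sub_eq_add_neg] at h
    have hab : a * b = 4 * ρ := by
      rw [ha_def, hb_def, zpow_neg]
      field_simp
    have ht0 : s * π ^ j ≠ 0 := mul_ne_zero hs0 (zpow_ne_zero _ hπ0)
    have hc : c = (1 + a) * (s * π ^ j) ^ 2 := by
      have hπm : π ^ (-m) * (π ^ j * π ^ j) = 1 := by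
        rw [← zpow_add₀ hπ0, ← hj, ← zpow_add₀ hπ0, neg_add_cancel, zpow_zero]
      linear_combination (-c) * hπm + (π ^ j * π ^ j) * hcs
    have hA : V.toAddValuation (1 + a) = (0 : ℤ) := by
      have hA0 : 1 + a ≠ 0 := by
        intro h
        rw [h, zero_mul] at hc
        exact hc0 hc
      obtain ⟨k, hk⟩ := V.toAddValuation.exists_coe_eq hA0
      have h := AddValuation.map_mul_of_eq_coe hk (AddValuation.map_pow_of_eq_coe
        (AddValuation.map_mul_of_eq_coe hs' (AddValuation.map_zpow_of_eq_coe hπ j)) 2)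
      rw [← hc, hm, WithTop.coe_inj] at h
      rw [hk, WithTop.coe_inj]
      push_cast at h
      omega
    have had (w : F) : V.toAddValuation (1 + a - w ^ 2) ≤ dc := by
      rw [← hdc, hc]
      exact NormDiscValuation.map_sub_sq_le_relDefect hA ht0 w
    have hd0 : 0 ≤ dc := by
      have h := had 0
      rw [zero_pow two_ne_zero, sub_zero, hA] at h
      exact_mod_cast h
    obtain ⟨hodd', hpos, hlt⟩ := AddValuation.odd_and_pos_and_lt he hπ hρ
      (hΔ ▸ hΔle) ha hA had
      (fun t ht => hcsq ⟨t * (s * π ^ j), by rw [hc, ht]; ring⟩)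
      (fun t ht => hcΔ ⟨t * (s * π ^ j), by rw [hc, ht, hΔ]; ring⟩) hd0
    have hB : V.toAddValuation (1 + b) = (0 : ℤ) := by
      refine AddValuation.map_one_add_of_pos ?_
      rw [hb]
      exact_mod_cast (by omega : 0 < 2 * e - dc)
    refine ⟨hB, NormDiscValuation.relDefect_one_add he hb ?_ (by omega) (by omega), fun h => ?_⟩
    · exact (even_two_mul e).sub_odd hodd'
    · have hBA : IsQuadraticNorm (1 + b) (1 + a) :=
        .of_mul_sq ht0 (hc ▸ .of_hilbertOne h20 h)
      have hN := hBA.one_sub_mul h20 (AddValuation.ne_zero_of_eq_coe ha)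
        (AddValuation.ne_zero_of_eq_coe hA) (AddValuation.ne_zero_of_eq_coe hB)
        (by rw [hab, ← hΔ]; exact AddValuation.ne_zero_of_eq_coe hΔ0)
      rw [hab, ← hΔ] at hN
      have hval := AddValuation.map_mul_of_eq_coe (AddValuation.map_mul_of_eq_coe ha hA) hB
      rw [add_zero, add_zero] at hval
      exact Int.not_even_iff_odd.2 hodd' (hnorm hval hN)
  · obtain rfl := hodd hod
    have hdc0 : dc = 0 := by
      rw [NormDiscValuation.relDefect_eq_zero_of_odd hm hod, WithTop.coe_inj] at hdc
      exact hdc.symm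
    exact ⟨hΔ0, by rw [hdc0, sub_zero, hΔd],
      fun h => Int.not_even_iff_odd.2 hod (hnorm hm (.of_hilbertOne h20 h))⟩
end
end

section
/- Let F be a dyadic local field. For every n-dimensional quadratic space W over F (n ≥ 2), there is, up to isometry, exactly one (n+2)-dimensional quadratic space V that represents every n-dimensional quadratic space except W. Explicitly, if W has determinant D, then V is the unique (n+2)-dimensional space of determinant -D not isometric to W ⊥ ℍ. -/
noncomputable section
open scoped Classical

variable {F : Type*}

/-- The diagonal quadratic space `[w 0, …, w (n-1)]`. -/
def diagQF [Field F] (n : ℕ) (w : Fin n → F) : QuadraticMap F (Fin n → F) F :=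
  QuadraticMap.weightedSumSquares F w

/-- `Q'` is represented by `Q`: there is an injective isometry from `Q'` into `Q`. -/
def QRep [Field F] {n k : ℕ} (Q : QuadraticMap F (Fin n → F) F)
    (Q' : QuadraticMap F (Fin k → F) F) : Prop :=
  ∃ f : Q' →qᵢ Q, Function.Injective f

/-- Weights of the diagonal space `ℍ^{(n-l)/2} ⊥ [t₁,…,t_l]`, where `l` is the length of
the list `tail` (each hyperbolic plane being `[1,-1]`). -/
def padDiag [Field F] (n : ℕ) (tail : List F) : Fin n → F := fun i =>
  if (i : ℕ) < n - tail.length then (if (i : ℕ) % 2 = 0 then 1 else -1)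
  else tail.getD ((i : ℕ) - (n - tail.length)) 0

section Symbol

variable [Field F]

lemma hilbertOne_comm {a b : F} : HilbertOne a b ↔ HilbertOne b a := by
  constructor <;> rintro ⟨x, y, h⟩ <;> exact ⟨y, x, by rw [← h]; ring⟩

lemma hilbertOne_iff_norm (h2 : (2 : F) ≠ 0) {a b : F} (ha : a ≠ 0) (hb : b ≠ 0) :
    HilbertOne a b ↔ ∃ x y : F, b = x ^ 2 - a * y ^ 2 := by
  constructor
  · rintro ⟨x, y, h⟩
    by_cases hy : y = 0
    · subst hy
      refine ⟨(b + 1) / 2, x * (b - 1) / 2, ?_⟩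
      field_simp
      linear_combination (b - 1) ^ 2 * h
    · refine ⟨1 / y, x / y, ?_⟩
      field_simp
      linear_combination h
  · rintro ⟨x, y, h⟩
    by_cases hx : x = 0
    · subst hx
      have hy : y ≠ 0 := by rintro rfl; simp_all
      refine ⟨(1 / a + 1) / 2, (1 / a - 1) / (2 * y), ?_⟩
      rw [h]
      field_simp
      ring
    · refine ⟨y / x, 1 / x, ?_⟩
      field_simp
      linear_combination h

lemma hilbertOne_neg_self (h2 : (2 : F) ≠ 0) {a : F} (ha : a ≠ 0) : HilbertOne a (-a) :=
  (hilbertOne_iff_norm h2 ha (neg_ne_zero.2 ha)).2 ⟨0, 1, by ring⟩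

lemma hilbertOne_sq {a t : F} (ht : t ≠ 0) : HilbertOne a (t ^ 2) :=
  ⟨0, 1 / t, by field_simp; ring⟩

lemma HilbertOne.mul_right (h2 : (2 : F) ≠ 0) {a b c : F} (ha : a ≠ 0) (hb : b ≠ 0) (hc : c ≠ 0)
    (h : HilbertOne a b) (h' : HilbertOne a c) : HilbertOne a (b * c) := by
  rw [hilbertOne_iff_norm h2 ha hb] at h
  rw [hilbertOne_iff_norm h2 ha hc] at h'
  rw [hilbertOne_iff_norm h2 ha (mul_ne_zero hb hc)]
  obtain ⟨x, y, rfl⟩ := h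
  obtain ⟨z, w, rfl⟩ := h'
  exact ⟨x * z + a * y * w, x * w + y * z, by ring⟩

lemma hilbertOne_mul_sq_right {a b t : F} (ht : t ≠ 0) :
    HilbertOne a (b * t ^ 2) ↔ HilbertOne a b := by
  constructor
  · rintro ⟨x, y, h⟩
    exact ⟨x, t * y, by rw [← h]; ring⟩
  · rintro ⟨x, y, h⟩
    exact ⟨x, y / t, by rw [← h]; field_simp⟩

lemma hilbertOne_mul_sq_left {a b t : F} (ht : t ≠ 0) :
    HilbertOne (a * t ^ 2) b ↔ HilbertOne a b := by
  rw [hilbertOne_comm, hilbertOne_mul_sq_right ht, hilbertOne_comm]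

lemma HilbertOne.of_mul_right (h2 : (2 : F) ≠ 0) {a b c : F} (ha : a ≠ 0) (hb : b ≠ 0)
    (hc : c ≠ 0) (h : HilbertOne a b) (h' : HilbertOne a (b * c)) : HilbertOne a c := by
  have := h.mul_right h2 ha hb (mul_ne_zero hb hc) h'
  rwa [show b * (b * c) = c * b ^ 2 by ring, hilbertOne_mul_sq_right hb] at this

/-- The properties of the Hilbert symbol of a local field from which the classification of
quadratic spaces follows: it is bimultiplicative and nondegenerate, and there are at least four
square classes. -/
structure HasHilbertSymbol (F : Type*) [Field F] : Prop where
  two_ne_zero : (2 : F) ≠ 0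
  mul_of_not : ∀ a b c : F, a ≠ 0 → b ≠ 0 → c ≠ 0 → ¬ HilbertOne a b → ¬ HilbertOne a c →
    HilbertOne a (b * c)
  exists_not : ∀ a : F, a ≠ 0 → ¬ IsSquare a → ∃ b : F, b ≠ 0 ∧ ¬ HilbertOne a b
  exists_indep : ∃ a b : F, ¬ IsSquare a ∧ ¬ IsSquare b ∧ ¬ IsSquare (a * b)

end Symbol

section ResidueField

open IsLocalRing

variable {O : Type*} [CommRing O]

lemma exists_root_of_mem [HenselianLocalRing O] {b c s : O}
    (h : s ^ 2 + b * s + c ∈ maximalIdeal O) (h' : IsUnit (2 * s + b)) :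
    ∃ y : O, y ^ 2 + b * y + c = 0 := by
  open Polynomial in
  obtain ⟨y, hy, -⟩ := HenselianLocalRing.is_henselian (X ^ 2 + C b * X + C c : O[X])
    (by monicity!) s (by simpa using h) (by simpa [one_add_one_eq_two] using h')
  exact ⟨y, by simpa using hy⟩

lemma two_mem_maximalIdeal [IsLocalRing O] (h2 : ¬ IsUnit (2 : O)) : (2 : O) ∈ maximalIdeal O :=
  (mem_maximalIdeal _).2 h2

lemma isUnit_of_sub_mem [IsLocalRing O] {x y : O} (hx : IsUnit x)
    (h : y - x ∈ maximalIdeal O) : IsUnit y := by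
  by_contra hy
  have : x ∈ maximalIdeal O := by
    simpa using (maximalIdeal O).sub_mem ((mem_maximalIdeal _).2 hy) h
  exact (mem_maximalIdeal _).1 this hx

lemma exists_sq_sub_mem [IsLocalRing O] [Finite (ResidueField O)] (h2 : ¬ IsUnit (2 : O))
    (r : O) : ∃ s : O, r - s ^ 2 ∈ maximalIdeal O := by
  have hc : (2 : ResidueField O) = 0 := by
    have := (residue_eq_zero_iff (2 : O)).2 (two_mem_maximalIdeal h2)
    rwa [map_ofNat] at this
  have : CharP (ResidueField O) 2 := CharTwo.of_one_ne_zero_of_two_eq_zero one_ne_zero hc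
  obtain ⟨s, hs⟩ := FiniteField.isSquare_of_char_two (ringChar.eq (ResidueField O) 2)
    (residue O r)
  obtain ⟨s, rfl⟩ := residue_surjective s
  refine ⟨s, ?_⟩
  rw [← residue_eq_zero_iff, map_sub, hs, map_pow]
  ring

lemma exists_artinSchreier (k : Type*) [Field k] [Finite k] (h2 : (2 : k) = 0) :
    ∃ ρ : k, (∀ s : k, s ^ 2 + s ≠ ρ) ∧
      ∀ r : k, (∃ s, s ^ 2 + s = r) ∨ ∃ s, s ^ 2 + s = r - ρ := by
  let f : k →+ k :=
    { toFun := fun s => s ^ 2 + s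
      map_zero' := by simp
      map_add' := fun x y => by linear_combination x * y * h2 }
  have hf : ∀ s, f s = s ^ 2 + s := fun s => rfl
  have hk : Nat.card f.ker = 2 := by
    have : (f.ker : Set k) = {0, 1} := by
      ext s
      simp only [SetLike.mem_coe, AddMonoidHom.mem_ker, hf, Set.mem_insert_iff,
        Set.mem_singleton_iff]
      constructor
      · intro h
        have : s * (s - 1) = 0 := by linear_combination h - s * h2
        simpa [sub_eq_zero] using this
      · rintro (rfl | rfl)
        · simp
        · linear_combination h2
    rw [← SetLike.coe_sort_coe, this, Nat.card_coe_set_eq, Set.ncard_pair zero_ne_one]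
  have hi : f.range.index = 2 := by
    have h1 := f.range.card_mul_index
    have h3 := f.ker.card_mul_index
    rw [AddSubgroup.index_ker, hk, ← h1, mul_comm] at h3
    exact (Nat.eq_of_mul_eq_mul_left Nat.card_pos h3).symm
  obtain ⟨ρ, hρ⟩ : ∃ ρ, ρ ∉ f.range := by
    by_contra! h
    rw [(AddSubgroup.eq_top_iff' _).2 h] at hi
    simp at hi
  refine ⟨ρ, fun s hs => hρ ⟨s, hs⟩, fun r => ?_⟩
  by_cases hr : r ∈ f.range
  · exact .inl hr
  · have : r + -ρ ∈ f.range := by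
      rw [AddSubgroup.add_mem_iff_of_index_two hi, neg_mem_iff]
      tauto
    right
    obtain ⟨s, hs⟩ := this
    exact ⟨s, by rw [← hf, hs]; ring⟩

end ResidueField

section UnramifiedUnit

open IsLocalRing

variable {O : Type*} [CommRing O]

/-- `s² + s - ρ` is irreducible over the residue field, and `ρ` generates the cokernel of the
Artin–Schreier map there. -/
structure IsArtinSchreierGen [IsLocalRing O] (ρ : O) : Prop where
  isUnit : ∀ s : O, IsUnit (s ^ 2 + s - ρ)
  mem_or_mem : ∀ r : O, (∃ s, s ^ 2 + s - r ∈ maximalIdeal O) ∨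
    ∃ s, s ^ 2 + s - (r - ρ) ∈ maximalIdeal O

lemma exists_isArtinSchreierGen [IsLocalRing O] [Finite (ResidueField O)]
    (h2 : ¬ IsUnit (2 : O)) : ∃ ρ : O, IsArtinSchreierGen ρ := by
  have hc : (2 : ResidueField O) = 0 := by
    have := (residue_eq_zero_iff (2 : O)).2 (two_mem_maximalIdeal h2)
    rwa [map_ofNat] at this
  obtain ⟨ρ, hρ, h⟩ := exists_artinSchreier (ResidueField O) hc
  obtain ⟨ρ, rfl⟩ := residue_surjective ρ
  refine ⟨ρ, fun s => ?_, fun r => ?_⟩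
  · by_contra hs
    have := (residue_eq_zero_iff _).2 ((mem_maximalIdeal _).2 hs)
    rw [map_sub, map_add, map_pow, sub_eq_zero] at this
    exact hρ _ this
  · refine (h (residue O r)).imp ?_ ?_ <;> rintro ⟨s, hs⟩ <;>
      obtain ⟨s, rfl⟩ := residue_surjective s <;> refine ⟨s, ?_⟩ <;>
      rw [← residue_eq_zero_iff] <;> simp [hs]

lemma isUnit_one_add [IsLocalRing O] {x : O} (hx : x ∈ maximalIdeal O) : IsUnit (1 + x) :=
  isUnit_of_sub_mem isUnit_one (by simpa using hx)

lemma isUnit_one_add_four_mul [IsLocalRing O] (h2 : ¬ IsUnit (2 : O)) (r : O) :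
    IsUnit (1 + 4 * r) := by
  refine isUnit_one_add ?_
  rw [show 4 * r = 2 * r * 2 by ring]
  exact (maximalIdeal O).mul_mem_left _ (two_mem_maximalIdeal h2)

lemma isSquare_one_add_four_mul [HenselianLocalRing O] (h2 : ¬ IsUnit (2 : O)) {r s : O}
    (h : s ^ 2 + s - r ∈ maximalIdeal O) : ∃ y, 1 + 4 * r = y ^ 2 := by
  obtain ⟨y, hy⟩ := exists_root_of_mem (b := 1) (c := -r) (s := s)
    (by rwa [one_mul, ← sub_eq_add_neg])
    (by
      rw [add_comm]
      exact isUnit_one_add ((maximalIdeal O).mul_mem_right _ (two_mem_maximalIdeal h2)))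
  exact ⟨1 + 2 * y, by linear_combination (-4) * hy⟩

lemma IsArtinSchreierGen.square_class [HenselianLocalRing O] (h2 : ¬ IsUnit (2 : O)) {ρ : O}
    (hρ : IsArtinSchreierGen ρ) (r : O) :
    (∃ y, 1 + 4 * r = y ^ 2) ∨ ∃ y, 1 + 4 * r = (1 + 4 * ρ) * y ^ 2 := by
  refine (hρ.mem_or_mem r).imp (fun ⟨s, hs⟩ => isSquare_one_add_four_mul h2 hs) ?_
  rintro ⟨s, hs⟩
  obtain ⟨d, hd⟩ := (isUnit_one_add_four_mul h2 ρ).exists_left_inv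
  have h4 : 2 * (2 * d * ρ * (r - ρ)) ∈ maximalIdeal O :=
    (maximalIdeal O).mul_mem_right _ (two_mem_maximalIdeal h2)
  obtain ⟨y, hy⟩ := isSquare_one_add_four_mul h2 (r := (r - ρ) * d) (s := s) (by
    convert add_mem hs h4 using 1
    linear_combination (-(r - ρ)) * hd)
  exact ⟨y, by rw [← hy]; linear_combination (-4) * (r - ρ) * hd⟩

lemma IsArtinSchreierGen.exists_norm_eq [HenselianLocalRing O] [Finite (ResidueField O)]
    (h2 : ¬ IsUnit (2 : O)) {ρ : O} (hρ : IsArtinSchreierGen ρ) {u : O} (hu : IsUnit u) :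
    ∃ x y : O, u = x ^ 2 + x * y - ρ * y ^ 2 := by
  obtain ⟨t, ht⟩ := exists_sq_sub_mem h2 u
  have htu : IsUnit t := by
    have := isUnit_of_sub_mem hu (y := t ^ 2) (by rw [← neg_sub]; exact neg_mem ht)
    exact (isUnit_pow_iff two_ne_zero).1 this
  have hρu : IsUnit ρ := by simpa using hρ.isUnit 0
  obtain ⟨d, hd⟩ := hρu.exists_left_inv
  obtain ⟨y, hy⟩ := exists_root_of_mem (b := -(t * d)) (c := (u - t ^ 2) * d) (s := 0)
    (by simpa using (maximalIdeal O).mul_mem_right d ht)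
    (by simpa using ⟨htu, IsUnit.of_mul_eq_one _ hd⟩)
  exact ⟨t, y, by linear_combination ρ * hy + (t * y - (u - t ^ 2)) * hd⟩

end UnramifiedUnit

section EvenOrder

open IsLocalRing

variable (O : Type*) [CommRing O] [Field F] [Algebra O F]

/-- `x` is a unit of the valuation ring `O` times a nonzero square. -/
def EvenOrd (x : F) : Prop :=
  ∃ u : O, IsUnit u ∧ ∃ t : F, t ≠ 0 ∧ x = algebraMap O F u * t ^ 2

variable {O}

lemma EvenOrd.of_isUnit {u : O} (hu : IsUnit u) : EvenOrd O (algebraMap O F u) :=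
  ⟨u, hu, 1, one_ne_zero, by simp⟩

lemma EvenOrd.mul {x y : F} (hx : EvenOrd O x) (hy : EvenOrd O y) : EvenOrd O (x * y) := by
  obtain ⟨u, hu, t, ht, rfl⟩ := hx
  obtain ⟨v, hv, w, hw, rfl⟩ := hy
  exact ⟨u * v, hu.mul hv, t * w, mul_ne_zero ht hw, by rw [map_mul]; ring⟩

lemma evenOrd_sq {t : F} (ht : t ≠ 0) : EvenOrd O (t ^ 2) :=
  ⟨1, isUnit_one, t, ht, by simp⟩

lemma EvenOrd.ne_zero {x : F} (hx : EvenOrd O x) : x ≠ 0 := by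
  obtain ⟨u, hu, t, ht, rfl⟩ := hx
  exact mul_ne_zero (hu.map (algebraMap O F)).ne_zero (pow_ne_zero 2 ht)

lemma evenOrd_mul_sq {x t : F} (ht : t ≠ 0) : EvenOrd O (x * t ^ 2) ↔ EvenOrd O x := by
  constructor
  · intro h
    have := h.mul (evenOrd_sq (O := O) (inv_ne_zero ht))
    rwa [mul_assoc, ← mul_pow, mul_inv_cancel₀ ht, one_pow, mul_one] at this
  · exact fun h => h.mul (evenOrd_sq ht)

lemma EvenOrd.of_mul {x y : F} (hx : EvenOrd O x) (hxy : EvenOrd O (x * y)) : EvenOrd O y := by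
  have := hx.mul hxy
  rwa [show x * (x * y) = y * x ^ 2 by ring, evenOrd_mul_sq hx.ne_zero] at this

lemma algebraMap_isUnit_ne_zero {u : O} (hu : IsUnit u) : algebraMap O F u ≠ 0 :=
  (hu.map (algebraMap O F)).ne_zero

variable [IsFractionRing O F]

lemma algebraMap_ne_zero_of_ne_zero {x : O} (hx : x ≠ 0) : algebraMap O F x ≠ 0 :=
  (map_ne_zero_iff _ (IsFractionRing.injective O F)).2 hx

variable [IsDomain O] [IsDiscreteValuationRing O]

lemma not_evenOrd_of_irreducible {ϖ : O} (hϖ : Irreducible ϖ) :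
    ¬ EvenOrd O (algebraMap O F ϖ) := by
  rintro ⟨u, hu, t, ht, h⟩
  obtain ⟨a, b, hb, rfl⟩ := IsFractionRing.div_surjective (A := O) t
  have hb0 : b ≠ 0 := nonZeroDivisors.ne_zero hb
  have hb' := algebraMap_ne_zero_of_ne_zero (F := F) hb0
  have ha0 : a ≠ 0 := by
    rintro rfl
    simp at ht
  rw [div_pow, mul_div_assoc', eq_div_iff (pow_ne_zero 2 hb')] at h
  have h' : ϖ * b ^ 2 = u * a ^ 2 :=
    IsFractionRing.injective O F (by simpa only [map_mul, map_pow] using h)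
  obtain ⟨m, v, rfl⟩ := IsDiscreteValuationRing.eq_unit_mul_pow_irreducible ha0 hϖ
  obtain ⟨n, w, rfl⟩ := IsDiscreteValuationRing.eq_unit_mul_pow_irreducible hb0 hϖ
  have e1 := IsDiscreteValuationRing.addVal_def (ϖ * (w * ϖ ^ n) ^ 2) (w ^ 2) hϖ (2 * n + 1)
    (by push_cast; ring)
  have e2 := IsDiscreteValuationRing.addVal_def (u * (v * ϖ ^ m) ^ 2) (hu.unit * v ^ 2) hϖ (2 * m)
    (by push_cast; rw [hu.unit_spec]; ring)
  rw [h', e2, Nat.cast_inj] at e1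
  omega

lemma evenOrd_or_evenOrd_mul {ϖ : O} (hϖ : Irreducible ϖ) {x : F} (hx : x ≠ 0) :
    EvenOrd O x ∨ EvenOrd O (algebraMap O F ϖ * x) := by
  obtain ⟨a, b, hb, rfl⟩ := IsFractionRing.div_surjective (A := O) x
  have hb' := algebraMap_ne_zero_of_ne_zero (F := F) (nonZeroDivisors.ne_zero hb)
  have ha0 : a ≠ 0 := by
    rintro rfl
    simp at hx
  have hϖ0 := algebraMap_ne_zero_of_ne_zero (F := F) hϖ.ne_zero
  obtain ⟨n, v, hv⟩ := IsDiscreteValuationRing.eq_unit_mul_pow_irreducible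
    (mul_ne_zero ha0 (nonZeroDivisors.ne_zero hb)) hϖ
  have hv' := congrArg (algebraMap O F) hv
  simp only [map_mul, map_pow] at hv'
  obtain ⟨k, rfl | rfl⟩ := n.even_or_odd'
  · refine .inl ⟨v, v.isUnit, algebraMap O F ϖ ^ k / algebraMap O F b, by positivity, ?_⟩
    field_simp
    linear_combination hv'
  · refine .inr ⟨v, v.isUnit, algebraMap O F ϖ ^ (k + 1) / algebraMap O F b, by positivity, ?_⟩
    field_simp
    linear_combination algebraMap O F ϖ * hv'

lemma evenOrd_mul_of_not {x y : F} (hx : x ≠ 0) (hy : y ≠ 0) (hx' : ¬ EvenOrd O x)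
    (hy' : ¬ EvenOrd O y) : EvenOrd O (x * y) := by
  obtain ⟨ϖ, hϖ⟩ := IsDiscreteValuationRing.exists_irreducible O
  have hϖ0 := algebraMap_ne_zero_of_ne_zero (F := F) hϖ.ne_zero
  have := ((evenOrd_or_evenOrd_mul hϖ hx).resolve_left hx').mul
    ((evenOrd_or_evenOrd_mul hϖ hy).resolve_left hy')
  rwa [show algebraMap O F ϖ * x * (algebraMap O F ϖ * y) = x * y * algebraMap O F ϖ ^ 2 by ring,
    evenOrd_mul_sq hϖ0] at this

lemma exists_irreducible_mul_sq {x : F} (hx : x ≠ 0) (hx' : ¬ EvenOrd O x) :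
    ∃ ϖ : O, Irreducible ϖ ∧ ∃ t : F, t ≠ 0 ∧ x = algebraMap O F ϖ * t ^ 2 := by
  obtain ⟨ϖ, hϖ⟩ := IsDiscreteValuationRing.exists_irreducible O
  have hϖ0 := algebraMap_ne_zero_of_ne_zero (F := F) hϖ.ne_zero
  obtain ⟨u, hu, t, ht, h⟩ := (evenOrd_or_evenOrd_mul hϖ hx).resolve_left hx'
  refine ⟨u * ϖ, ?_, t / algebraMap O F ϖ, by positivity, ?_⟩
  · obtain ⟨u, rfl⟩ := hu
    exact (irreducible_units_mul u).2 hϖ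
  · rw [map_mul]
    field_simp
    linear_combination h

/-- The norm form of the unramified quadratic extension takes values of even order only. -/
lemma IsArtinSchreierGen.evenOrd_norm {ρ : O} (hρ : IsArtinSchreierGen ρ) {x y : F}
    (hxy : x ≠ 0 ∨ y ≠ 0) : EvenOrd O (x ^ 2 + x * y - algebraMap O F ρ * y ^ 2) := by
  have key : ∀ r : O, IsUnit (1 + r - ρ * r ^ 2) := by
    intro r
    by_cases hr : IsUnit r
    · obtain ⟨d, hd⟩ := hr.exists_left_inv
      have := (hr.pow 2).mul (hρ.isUnit d)
      convert this using 1
      linear_combination (-(1 + d * r + r)) * hd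
    · rw [add_sub_assoc]
      refine isUnit_one_add (sub_mem ((mem_maximalIdeal _).2 hr) ?_)
      rw [pow_two, ← mul_assoc]
      exact (maximalIdeal O).mul_mem_left _ ((mem_maximalIdeal _).2 hr)
  by_cases hy : y = 0
  · subst hy
    simpa using evenOrd_sq (O := O) (hxy.resolve_right (by simp))
  rcases ValuationRing.isInteger_or_isInteger O (x / y) with ⟨r, hr⟩ | ⟨r, hr⟩
  · refine ⟨_, hρ.isUnit r, y, hy, ?_⟩
    rw [map_sub, map_add, map_pow, hr]
    field_simp
  · by_cases hx : x = 0
    · subst hx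
      refine ⟨_, hρ.isUnit 0, y, hy, ?_⟩
      simp
    · refine ⟨_, key r, x, hx, ?_⟩
      rw [map_sub, map_add, map_mul, map_pow, hr, map_one]
      field_simp

/-- The Hilbert symbol of the unit `1 + 4ρ` of quadratic defect `4 * O` detects the parity of the
order. -/
lemma IsArtinSchreierGen.hilbertOne_iff [HenselianLocalRing O] [Finite (ResidueField O)]
    (h2 : ¬ IsUnit (2 : O)) (h2' : (2 : F) ≠ 0) {ρ : O} (hρ : IsArtinSchreierGen ρ) {b : F}
    (hb : b ≠ 0) : HilbertOne (algebraMap O F (1 + 4 * ρ)) b ↔ EvenOrd O b := by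
  have hΔ : algebraMap O F (1 + 4 * ρ) ≠ 0 :=
    ((isUnit_one_add_four_mul h2 ρ).map (algebraMap O F)).ne_zero
  constructor
  · intro h
    rw [hilbertOne_iff_norm h2' hΔ hb] at h
    obtain ⟨x, y, rfl⟩ := h
    convert hρ.evenOrd_norm (x := x - y) (y := 2 * y) ?_ using 1
    · rw [map_add, map_mul, map_one, map_ofNat]
      ring
    · by_contra! h
      have hy : y = 0 := by simpa [h2'] using h.2
      subst hy
      have hx : x = 0 := by simpa using h.1
      subst hx
      simp at hb
  · rintro ⟨u, hu, t, ht, rfl⟩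
    rw [hilbertOne_mul_sq_right ht,
      hilbertOne_iff_norm h2' hΔ (hu.map (algebraMap O F)).ne_zero]
    obtain ⟨x, y, rfl⟩ := hρ.exists_norm_eq h2 hu
    refine ⟨algebraMap O F x + algebraMap O F y / 2, algebraMap O F y / 2, ?_⟩
    simp only [map_sub, map_add, map_mul, map_pow, map_one, map_ofNat]
    field_simp
    ring

end EvenOrder

section LocalSymbol

open IsLocalRing

variable {O : Type*} [CommRing O] [IsDomain O] [IsDiscreteValuationRing O]

lemma exists_mul_eq_of_mem {ϖ x : O} (hϖ : Irreducible ϖ) (hx : x ∈ maximalIdeal O) :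
    ∃ c, x = ϖ * c := by
  rw [hϖ.maximalIdeal_eq, Ideal.mem_span_singleton] at hx
  exact hx

lemma irreducible_mul_mem {ϖ : O} (hϖ : Irreducible ϖ) (x : O) : ϖ * x ∈ maximalIdeal O :=
  (maximalIdeal O).mul_mem_right _ ((mem_maximalIdeal _).2 hϖ.not_isUnit)

lemma exists_two_eq {ϖ : O} (hϖ : Irreducible ϖ) (h2 : (2 : O) ≠ 0) :
    ∃ (e : ℕ) (v : O), IsUnit v ∧ 2 = v * ϖ ^ e := by
  obtain ⟨e, v, h⟩ := IsDiscreteValuationRing.eq_unit_mul_pow_irreducible h2 hϖ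
  exact ⟨e, v, v.isUnit, h⟩

variable [Finite (ResidueField O)]

lemma exists_one_add_even {ϖ v : O} (hϖ : Irreducible ϖ) (hv2 : ¬ IsUnit (2 : O)) {e i : ℕ}
    (h2 : 2 = v * ϖ ^ e) (hi : i < e) {r : O} (hr : IsUnit (1 + ϖ ^ (2 * i) * r)) :
    ∃ s r', IsUnit s ∧ 1 + ϖ ^ (2 * i) * r = s ^ 2 * (1 + ϖ ^ (2 * i + 1) * r') := by
  obtain ⟨t, ht⟩ := exists_sq_sub_mem hv2 r
  obtain ⟨c, hc⟩ := exists_mul_eq_of_mem hϖ ht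
  obtain ⟨k, rfl⟩ := Nat.exists_eq_add_of_lt hi
  have key : 1 + ϖ ^ (2 * i) * r =
      (1 + ϖ ^ i * t) ^ 2 + ϖ ^ (2 * i + 1) * (c - v * ϖ ^ k * t) := by
    linear_combination ϖ ^ (2 * i) * hc - ϖ ^ i * t * h2
  have hs : IsUnit (1 + ϖ ^ i * t) := by
    refine (isUnit_pow_iff two_ne_zero).1 (isUnit_of_sub_mem hr ?_)
    rw [show (1 + ϖ ^ i * t) ^ 2 - (1 + ϖ ^ (2 * i) * r)
      = ϖ * (ϖ ^ (2 * i) * -(c - v * ϖ ^ k * t)) by linear_combination -key]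
    exact irreducible_mul_mem hϖ _
  obtain ⟨q, hq⟩ := hs.exists_left_inv
  refine ⟨_, (c - v * ϖ ^ k * t) * q ^ 2, hs, ?_⟩
  rw [key]
  linear_combination (-(ϖ ^ (2 * i + 1) * (c - v * ϖ ^ k * t) * (q * (1 + ϖ ^ i * t) + 1))) * hq

lemma exists_one_add_odd {ϖ : O} (hϖ : Irreducible ϖ) (h2 : ¬ IsUnit (2 : O)) (i : ℕ) (r : O) :
    ∃ s r', 1 + ϖ ^ (2 * i + 1) * r = (1 - ϖ * s ^ 2) * (1 + ϖ ^ (2 * i + 2) * r') := by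
  obtain ⟨s, hs⟩ := exists_sq_sub_mem h2 (-r)
  obtain ⟨c, hc⟩ := exists_mul_eq_of_mem hϖ hs
  obtain ⟨q, hq⟩ := (isUnit_one_add (x := -(ϖ * (ϖ ^ i * s) ^ 2))
    (neg_mem (irreducible_mul_mem hϖ _))).exists_left_inv
  refine ⟨ϖ ^ i * s, -c * q, ?_⟩
  linear_combination (-ϖ ^ (2 * i + 1)) * hc + ϖ ^ (2 * i + 2) * c * hq

lemma exists_norm_mul_one_add {ϖ v : O} (hϖ : Irreducible ϖ) (hv2 : ¬ IsUnit (2 : O)) {e : ℕ}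
    (h2 : 2 = v * ϖ ^ e) {u : O} (hu : IsUnit u) :
    ∀ j ≤ 2 * e, ∃ x y r, u = (x ^ 2 - ϖ * y ^ 2) * (1 + ϖ ^ j * r) := by
  intro j
  induction j with
  | zero => exact fun _ => ⟨1, 0, u - 1, by ring⟩
  | succ j ih =>
    intro hj
    obtain ⟨x, y, r, h⟩ := ih (by omega)
    have hr : IsUnit (1 + ϖ ^ j * r) := isUnit_of_mul_isUnit_right (h ▸ hu)
    obtain ⟨i, rfl | rfl⟩ := j.even_or_odd'
    · obtain ⟨s, r', -, h'⟩ := exists_one_add_even hϖ hv2 h2 (by omega) hr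
      exact ⟨x * s, y * s, r', by rw [h, h']; ring⟩
    · obtain ⟨s, r', h'⟩ := exists_one_add_odd hϖ hv2 i r
      exact ⟨x + ϖ * y * s, x * s + y, r', by rw [h, h']; ring⟩

lemma exists_norm_mul_one_add_four {ϖ : O} (hϖ : Irreducible ϖ) (h2 : ¬ IsUnit (2 : O))
    (h0 : (2 : O) ≠ 0) {u : O} (hu : IsUnit u) :
    ∃ x y r, u = (x ^ 2 - ϖ * y ^ 2) * (1 + 4 * r) := by
  obtain ⟨e, v, hv, he⟩ := exists_two_eq hϖ h0
  obtain ⟨x, y, r, h⟩ := exists_norm_mul_one_add hϖ h2 he hu _ le_rfl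
  obtain ⟨d, hd⟩ := hv.exists_left_inv
  refine ⟨x, y, d ^ 2 * r, ?_⟩
  have h4 : (4 : O) * d ^ 2 = ϖ ^ (2 * e) := by
    linear_combination d ^ 2 * (2 + v * ϖ ^ e) * he + ϖ ^ (2 * e) * (d * v + 1) * hd
  rw [h, ← mul_assoc, h4]

variable [Field F] [Algebra O F] [IsFractionRing O F]

namespace IsArtinSchreierGen

variable [HenselianLocalRing O] {ρ : O} (hρ : IsArtinSchreierGen ρ) (h2 : ¬ IsUnit (2 : O))
  (h0 : (2 : F) ≠ 0)

include hρ h2 h0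

lemma hilbertOne_or_of_isUnit {ϖ u : O} (hϖ : Irreducible ϖ) (hu : IsUnit u) :
    HilbertOne (algebraMap O F ϖ) (algebraMap O F u) ∨
      HilbertOne (algebraMap O F ϖ) (algebraMap O F (1 + 4 * ρ) * algebraMap O F u) := by
  have hϖ0 := algebraMap_ne_zero_of_ne_zero (F := F) hϖ.ne_zero
  have hu0 := algebraMap_isUnit_ne_zero (F := F) hu
  have hΔ := algebraMap_isUnit_ne_zero (F := F) (isUnit_one_add_four_mul h2 ρ)
  have h0' : (2 : O) ≠ 0 := by
    intro h
    exact h0 (by rw [← map_ofNat (algebraMap O F), h, map_zero])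
  obtain ⟨x, y, r, h⟩ := exists_norm_mul_one_add_four hϖ h2 h0' hu
  rw [hilbertOne_iff_norm h0 hϖ0 hu0, hilbertOne_iff_norm h0 hϖ0 (mul_ne_zero hΔ hu0)]
  refine (hρ.square_class h2 r).imp ?_ ?_ <;> rintro ⟨z, hz⟩
  · refine ⟨algebraMap O F (x * z), algebraMap O F (y * z), ?_⟩
    simp only [← map_mul, ← map_pow, ← map_sub]
    rw [h, hz]
    ring_nf
  · refine ⟨algebraMap O F ((1 + 4 * ρ) * x * z), algebraMap O F ((1 + 4 * ρ) * y * z), ?_⟩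
    simp only [← map_mul, ← map_pow, ← map_sub]
    rw [h, hz]
    ring_nf

lemma hilbertOne_or {a b : F} (ha : a ≠ 0) (ha' : ¬ EvenOrd O a) (hb : b ≠ 0) :
    HilbertOne a b ∨ HilbertOne a (algebraMap O F (1 + 4 * ρ) * b) := by
  have hΔ := algebraMap_isUnit_ne_zero (F := F) (isUnit_one_add_four_mul h2 ρ)
  obtain ⟨ϖ, hϖ, t, ht, rfl⟩ := exists_irreducible_mul_sq ha ha'
  have hϖ0 := algebraMap_ne_zero_of_ne_zero (F := F) hϖ.ne_zero
  simp only [hilbertOne_mul_sq_left ht]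
  have even : ∀ b, EvenOrd O b → HilbertOne (algebraMap O F ϖ) b ∨
      HilbertOne (algebraMap O F ϖ) (algebraMap O F (1 + 4 * ρ) * b) := by
    rintro _ ⟨u, hu, s, hs, rfl⟩
    rw [← mul_assoc, hilbertOne_mul_sq_right hs, hilbertOne_mul_sq_right hs]
    exact hρ.hilbertOne_or_of_isUnit h2 h0 hϖ hu
  rcases evenOrd_or_evenOrd_mul hϖ hb with h | h
  · exact even b h
  · have h' : EvenOrd O (-algebraMap O F ϖ * b) := by
      have := (EvenOrd.of_isUnit (F := F) (isUnit_one (M := O)).neg).mul h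
      simpa using this
    have hn := hilbertOne_neg_self h0 hϖ0
    have hn0 := neg_ne_zero.2 hϖ0
    refine (even _ h').imp (fun h => hn.of_mul_right h0 hϖ0 hn0 hb h) fun h => ?_
    rw [mul_left_comm] at h
    exact hn.of_mul_right h0 hϖ0 hn0 (mul_ne_zero hΔ hb) h

lemma hilbertOne_mul_of_odd {a b c : F} (ha : a ≠ 0) (hb : b ≠ 0) (hb' : ¬ EvenOrd O b)
    (hc : c ≠ 0) (hc' : ¬ EvenOrd O c) (hab : ¬ HilbertOne a b) (hac : ¬ HilbertOne a c) :
    HilbertOne a (b * c) := by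
  have hΔ := algebraMap_isUnit_ne_zero (F := F) (isUnit_one_add_four_mul h2 ρ)
  rw [hilbertOne_comm] at hab hac
  have hb'' := (hρ.hilbertOne_or h2 h0 hb hb' ha).resolve_left hab
  have hc'' := (hρ.hilbertOne_or h2 h0 hc hc' ha).resolve_left hac
  rw [hilbertOne_comm] at hb'' hc''
  have h := hb''.mul_right h0 (mul_ne_zero hΔ ha) hb hc hc''
  have h' := (hρ.hilbertOne_iff h2 h0 (mul_ne_zero hb hc)).2 (evenOrd_mul_of_not hb hc hb' hc')
  rw [hilbertOne_comm] at h h' ⊢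
  exact h'.of_mul_right h0 (mul_ne_zero hb hc) hΔ ha h

lemma hilbertOne_mul_of_even_odd {a b c : F} (ha : a ≠ 0) (hb : EvenOrd O b)
    (hc : c ≠ 0) (hc' : ¬ EvenOrd O c) (hab : ¬ HilbertOne a b) (hac : ¬ HilbertOne a c) :
    HilbertOne a (b * c) := by
  by_contra h
  have := hρ.hilbertOne_mul_of_odd h2 h0 ha hc hc' (mul_ne_zero hb.ne_zero hc)
    (fun h => hc' (hb.of_mul h)) hac h
  rw [show c * (b * c) = b * c ^ 2 by ring, hilbertOne_mul_sq_right hc] at this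
  exact hab this

lemma hilbertOne_mul_of_not {a b c : F} (ha : a ≠ 0) (hb : b ≠ 0) (hc : c ≠ 0)
    (hab : ¬ HilbertOne a b) (hac : ¬ HilbertOne a c) : HilbertOne a (b * c) := by
  by_cases hb' : EvenOrd O b
  · by_cases hc' : EvenOrd O c
    · by_cases hd : ∃ d : F, d ≠ 0 ∧ ¬ EvenOrd O d ∧ ¬ HilbertOne a d
      · obtain ⟨d, hd, hd', had⟩ := hd
        have := (hρ.hilbertOne_mul_of_even_odd h2 h0 ha hb' hd hd' hab had).mul_right h0 ha
          (mul_ne_zero hb hd) (mul_ne_zero hc hd)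
          (hρ.hilbertOne_mul_of_even_odd h2 h0 ha hc' hd hd' hac had)
        rwa [mul_mul_mul_comm, ← pow_two d, hilbertOne_mul_sq_right hd] at this
      · push Not at hd
        obtain ⟨ϖ, hϖ⟩ := IsDiscreteValuationRing.exists_irreducible O
        have hϖ0 := algebraMap_ne_zero_of_ne_zero (F := F) hϖ.ne_zero
        have hϖ' := not_evenOrd_of_irreducible (F := F) hϖ
        have := (hd _ hϖ0 hϖ').of_mul_right h0 ha hϖ0 hb (hd _ (mul_ne_zero hϖ0 hb)
          (by rw [mul_comm]; exact fun h => hϖ' (hb'.of_mul h)))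
        exact absurd this hab
    · exact hρ.hilbertOne_mul_of_even_odd h2 h0 ha hb' hc hc' hab hac
  · by_cases hc' : EvenOrd O c
    · rw [mul_comm]
      exact hρ.hilbertOne_mul_of_even_odd h2 h0 ha hc' hb hb' hac hab
    · exact hρ.hilbertOne_mul_of_odd h2 h0 ha hb hb' hc hc' hab hac

/-- A unit of odd quadratic defect of order `j < 2 * e` pairs nontrivially with a unit of level
`2 * e - j`. -/
lemma not_hilbertOne_one_add {ϖ r β : O} (hϖ : Irreducible ϖ) (hr : IsUnit r) (i : ℕ)
    (hβ : β ∈ maximalIdeal O) (h : ϖ ^ (2 * i + 1) * r * β = -(4 * ρ)) :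
    ¬ HilbertOne (algebraMap O F (1 + ϖ ^ (2 * i + 1) * r)) (algebraMap O F (1 + β)) := by
  have hϖ0 := algebraMap_ne_zero_of_ne_zero (F := F) hϖ.ne_zero
  have hr0 := algebraMap_isUnit_ne_zero (F := F) hr
  set α := ϖ ^ (2 * i + 1) * r with hα
  have hα0 : algebraMap O F α ≠ 0 :=
    algebraMap_ne_zero_of_ne_zero (mul_ne_zero (pow_ne_zero _ hϖ.ne_zero) hr.ne_zero)
  have hαm : α ∈ maximalIdeal O := by
    rw [hα, pow_succ', mul_assoc]
    exact irreducible_mul_mem hϖ _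
  have hX := algebraMap_isUnit_ne_zero (F := F) (isUnit_one_add hαm)
  have hY := algebraMap_isUnit_ne_zero (F := F) (isUnit_one_add hβ)
  have hΔ := algebraMap_isUnit_ne_zero (F := F) (isUnit_one_add_four_mul h2 ρ)
  intro hH
  have hXY := HilbertOne.mul_right h0 hX (neg_ne_zero.2 hα0) hY
    (a := algebraMap O F (1 + α)) ⟨1, 1, by rw [map_add, map_one]; ring⟩ hH
  obtain ⟨x, y, hxy⟩ := hXY
  have h' := congrArg (algebraMap O F) h
  simp only [map_mul, map_neg, map_ofNat] at h'
  have hnorm : HilbertOne (algebraMap O F (1 + 4 * ρ))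
      (algebraMap O F ((1 + α) * (1 + β)) * algebraMap O F α) := by
    rw [hilbertOne_comm, hilbertOne_iff_norm h0 (by rw [map_mul]; positivity) hΔ]
    refine ⟨algebraMap O F (1 + α) * x + -algebraMap O F α * algebraMap O F (1 + β) * y,
      x - y, ?_⟩
    simp only [map_mul, map_add, map_one, map_ofNat] at hxy ⊢
    linear_combination h' * (1 : F) -
      (1 + algebraMap O F α - algebraMap O F α * (1 + algebraMap O F β)) * hxy
  rw [hρ.hilbertOne_iff h2 h0 (by rw [map_mul]; positivity)] at hnorm
  have h3 := (EvenOrd.of_isUnit ((isUnit_one_add hαm).mul (isUnit_one_add hβ))).of_mul hnorm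
  rw [hα, show algebraMap O F (ϖ ^ (2 * i + 1) * r) =
    algebraMap O F r * algebraMap O F ϖ * (algebraMap O F ϖ ^ i) ^ 2 by
      simp only [map_mul, map_pow]; ring, evenOrd_mul_sq (pow_ne_zero _ hϖ0)] at h3
  exact not_evenOrd_of_irreducible hϖ ((EvenOrd.of_isUnit hr).of_mul h3)

lemma exists_not_hilbertOne_or {ϖ v u : O} (hϖ : Irreducible ϖ) {e : ℕ} (he : 2 = v * ϖ ^ e)
    (hu : IsUnit u) : ∀ j ≤ 2 * e, (∃ b : F, b ≠ 0 ∧ ¬ HilbertOne (algebraMap O F u) b) ∨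
      ∃ t r, IsUnit t ∧ u = t ^ 2 * (1 + ϖ ^ j * r) := by
  intro j
  induction j with
  | zero => exact fun _ => .inr ⟨1, u - 1, isUnit_one, by ring⟩
  | succ j ih =>
    intro hj
    refine (ih (by omega)).elim .inl ?_
    rintro ⟨t, r, ht, h⟩
    have hr : IsUnit (1 + ϖ ^ j * r) := isUnit_of_mul_isUnit_right (h ▸ hu)
    obtain ⟨i, rfl | rfl⟩ := j.even_or_odd'
    · obtain ⟨s, r', hs, h'⟩ := exists_one_add_even hϖ h2 he (by omega) hr
      exact .inr ⟨t * s, r', ht.mul hs, by rw [h, h']; ring⟩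
    · by_cases hr' : IsUnit r
      · left
        obtain ⟨q, hq⟩ := hr'.exists_left_inv
        obtain ⟨k, hk⟩ := Nat.exists_eq_add_of_le hj
        have hβ : -(ϖ * (ϖ ^ k * v ^ 2 * ρ * q)) ∈ maximalIdeal O :=
          neg_mem (irreducible_mul_mem hϖ _)
        refine ⟨_, algebraMap_isUnit_ne_zero (isUnit_one_add hβ), ?_⟩
        rw [h, mul_comm, map_mul, map_pow, hilbertOne_mul_sq_left (algebraMap_isUnit_ne_zero ht)]
        refine hρ.not_hilbertOne_one_add h2 h0 hϖ hr' i hβ ?_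
        have h4 : (4 : O) = v ^ 2 * ϖ ^ (2 * i + 1 + 1 + k) := by
          rw [← hk]
          linear_combination (2 + v * ϖ ^ e) * he
        linear_combination ρ * h4 - ϖ ^ (2 * i + 1 + 1 + k) * v ^ 2 * ρ * hq
      · obtain ⟨c, rfl⟩ := exists_mul_eq_of_mem hϖ ((mem_maximalIdeal _).2 hr')
        exact .inr ⟨t, c, ht, by rw [h]; ring⟩

lemma exists_not_hilbertOne {a : F} (ha : a ≠ 0) (ha' : ¬ IsSquare a) :
    ∃ b : F, b ≠ 0 ∧ ¬ HilbertOne a b := by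
  have hΔ := algebraMap_isUnit_ne_zero (F := F) (isUnit_one_add_four_mul h2 ρ)
  obtain ⟨ϖ, hϖ⟩ := IsDiscreteValuationRing.exists_irreducible O
  by_cases he : EvenOrd O a
  · obtain ⟨u, hu, t, ht, rfl⟩ := he
    simp only [hilbertOne_mul_sq_left ht]
    obtain ⟨e, v, hv, he⟩ := exists_two_eq hϖ (O := O) (by
      intro h
      exact h0 (by rw [← map_ofNat (algebraMap O F), h, map_zero]))
    refine (hρ.exists_not_hilbertOne_or h2 h0 hϖ he hu _ le_rfl).elim id ?_
    rintro ⟨s, r, hs, h⟩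
    obtain ⟨d, hd⟩ := hv.exists_left_inv
    have h4 : ϖ ^ (2 * e) * r = 4 * (d ^ 2 * r) := by
      linear_combination (-(d ^ 2 * (2 + v * ϖ ^ e) * r)) * he -
        ϖ ^ (2 * e) * (d * v + 1) * r * hd
    rw [h4] at h
    rcases hρ.square_class h2 (d ^ 2 * r) with ⟨y, hy⟩ | ⟨y, hy⟩
    · refine absurd ⟨algebraMap O F (s * y) * t, ?_⟩ ha'
      rw [h, hy]
      simp only [map_mul, map_pow]
      ring
    · refine ⟨algebraMap O F ϖ, algebraMap_ne_zero_of_ne_zero hϖ.ne_zero, ?_⟩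
      have hsy : algebraMap O F (s * y) ≠ 0 := by
        have := algebraMap_isUnit_ne_zero (F := F) (hy ▸ isUnit_one_add_four_mul h2 (d ^ 2 * r))
        rw [map_mul, map_pow] at this
        rw [map_mul]
        exact mul_ne_zero (algebraMap_isUnit_ne_zero hs)
          (pow_ne_zero_iff two_ne_zero |>.1 (right_ne_zero_of_mul this))
      rw [h, hy, show algebraMap O F (s ^ 2 * ((1 + 4 * ρ) * y ^ 2)) =
        algebraMap O F (1 + 4 * ρ) * algebraMap O F (s * y) ^ 2 by
          rw [← map_pow, ← map_mul]; ring_nf, hilbertOne_mul_sq_left hsy,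
        hρ.hilbertOne_iff h2 h0 (algebraMap_ne_zero_of_ne_zero hϖ.ne_zero)]
      exact not_evenOrd_of_irreducible hϖ
  · refine ⟨_, hΔ, ?_⟩
    rwa [hilbertOne_comm, hρ.hilbertOne_iff h2 h0 ha]

lemma hasHilbertSymbol : HasHilbertSymbol F where
  two_ne_zero := h0
  mul_of_not _ _ _ ha hb hc := hρ.hilbertOne_mul_of_not h2 h0 ha hb hc
  exists_not _ ha := hρ.exists_not_hilbertOne h2 h0 ha
  exists_indep := by
    obtain ⟨ϖ, hϖ⟩ := IsDiscreteValuationRing.exists_irreducible O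
    have hϖ0 := algebraMap_ne_zero_of_ne_zero (F := F) hϖ.ne_zero
    have hϖ' := not_evenOrd_of_irreducible (F := F) hϖ
    have hΔ := isUnit_one_add_four_mul h2 ρ
    have sq : ∀ x : F, x ≠ 0 → IsSquare x → EvenOrd O x := by
      rintro _ hx ⟨t, rfl⟩
      rw [← pow_two]
      exact evenOrd_sq (left_ne_zero_of_mul hx)
    refine ⟨algebraMap O F (1 + 4 * ρ), algebraMap O F ϖ, ?_, fun h => hϖ' (sq _ hϖ0 h),
      fun h => hϖ' ?_⟩
    · rintro ⟨t, ht⟩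
      have ht0 : t ≠ 0 := left_ne_zero_of_mul (ht ▸ algebraMap_isUnit_ne_zero (F := F) hΔ)
      rw [← hρ.hilbertOne_iff h2 h0 hϖ0, ht, ← pow_two, hilbertOne_comm] at hϖ'
      exact hϖ' (hilbertOne_sq ht0)
    · exact (EvenOrd.of_isUnit hΔ).of_mul
        (sq _ (mul_ne_zero (algebraMap_isUnit_ne_zero hΔ) hϖ0) h)

end IsArtinSchreierGen

end LocalSymbol

section Integers

open scoped NormedField Valued Pointwise
open IsLocalRing

lemma exists_integers_of_properSpace (K : Type*) [NontriviallyNormedField K]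
    [IsUltrametricDist K] [ProperSpace K] (h2 : ‖(2 : K)‖ < 1) :
    ∃ O : Subring K, IsDiscreteValuationRing O ∧ IsFractionRing O K ∧
      ∃ _ : HenselianLocalRing O, Finite (ResidueField O) ∧ ¬ IsUnit (2 : O) := by
  have hc : CompactSpace 𝒪[K] := by
    refine isCompact_iff_compactSpace.mp (?_ : IsCompact (𝒪[K] : Set K))
    convert isCompact_closedBall (0 : K) 1
    ext x
    simp [Valued.integer.mem_iff]
  let hn : (Valued.v : Valuation K NNReal).RankOne :=
    inferInstanceAs (NormedField.valuation (K := K)).RankOne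
  have hd : IsDiscreteValuationRing 𝒪[K] := Valued.integer.isDiscreteValuationRing_of_compactSpace
  have hr : Finite 𝓀[K] :=
    (Valued.integer.compactSpace_iff_completeSpace_and_isDiscreteValuationRing_and_finite_residueField.mp
    hc).2.2
  have ha : IsAdicComplete 𝓂[K] 𝒪[K] :=
   { prec' := by
      intro f hf
      let S n : Set 𝒪[K] := f n +ᵥ ((𝓂[K] ^ n : Ideal 𝒪[K]) : Set 𝒪[K])
      have hS n : S (n + 1) ⊆ S n := by
        apply (Set.vadd_set_subset_vadd_set_iff.mpr (Ideal.pow_le_pow_right n.le_succ)).trans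
        simpa [S] using (hf n.le_succ).symm
      have h n : IsClosed (S n) := (IsNoetherianRing.isClosed_ideal (𝓂[K] ^ n)).vadd (f n)
      obtain ⟨L, hL⟩ := (h 0).isCompact.nonempty_iInter_of_sequence_nonempty_isCompact_isClosed S hS
        (by simp [S]) h
      refine ⟨L, fun n ↦ ?_⟩
      obtain ⟨y, hy, rfl⟩ := Set.mem_iInter.mp hL n
      simpa [SModEq.sub_mem] using hy }
  refine ⟨𝒪[K], hd, inferInstance, ⟨?_⟩, hr, ?_⟩
  · intro f hf a h1 h2
    exact HenselianRing.is_henselian (I := 𝓂[K]) f hf a h1 (h2.map _)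
  · intro h
    have := Valued.integer.norm_coe_unit h.unit
    rw [IsUnit.unit_spec] at this
    exact h2.ne this

lemma exists_integers (F : Type*) [Field F] [Algebra ℚ_[2] F]
    [FiniteDimensional ℚ_[2] F] :
    ∃ O : Subring F, IsDiscreteValuationRing O ∧ IsFractionRing O F ∧
      ∃ _ : HenselianLocalRing O, Finite (ResidueField O) ∧ ¬ IsUnit (2 : O) := by
  let := spectralNorm.nontriviallyNormedField ℚ_[2] F
  let := spectralNorm.normedSpace ℚ_[2] F
  have : IsUltrametricDist F := IsUltrametricDist.isUltrametricDist_of_isNonarchimedean_norm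
    (isNonarchimedean_spectralNorm (K := ℚ_[2]) (L := F))
  have : ProperSpace F := FiniteDimensional.proper ℚ_[2] F
  refine exists_integers_of_properSpace F ?_
  have := spectralNorm_extends (K := ℚ_[2]) (L := F) 2
  change spectralNorm ℚ_[2] F 2 < 1
  rw [map_ofNat] at this
  rw [this]
  have := Padic.norm_p (p := 2)
  norm_num at this ⊢
  rw [this]; norm_num

lemma hasHilbertSymbol_of_finiteDimensional (F : Type*) [Field F] [Algebra ℚ_[2] F]
    [FiniteDimensional ℚ_[2] F] : HasHilbertSymbol F := by
  obtain ⟨O, _, _, _, _, h2⟩ := exists_integers F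
  obtain ⟨ρ, hρ⟩ := exists_isArtinSchreierGen h2
  have : CharZero F := charZero_of_injective_algebraMap (algebraMap ℚ_[2] F).injective
  exact hρ.hasHilbertSymbol h2 two_ne_zero

end Integers

section DiagonalForms

open Matrix

variable {n k : ℕ}

lemma exists_eq_cons (w : Fin (n + 1) → F) : ∃ a v, w = vecCons a v :=
  ⟨vecHead w, vecTail w, (cons_head_tail w).symm⟩

variable [Field F]

lemma diagQF_apply (w x : Fin n → F) : diagQF n w x = ∑ i, w i * x i ^ 2 := by
  simp [diagQF, QuadraticMap.weightedSumSquares_apply, pow_two]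

lemma diagQF_cons (a : F) (w : Fin n → F) (x : Fin (n + 1) → F) :
    diagQF (n + 1) (vecCons a w) x = a * x 0 ^ 2 + diagQF n w (vecTail x) := by
  simp [diagQF_apply, Fin.sum_univ_succ, vecTail]

lemma diagQF_cons_one_zero (a : F) (w : Fin n → F) :
    diagQF (n + 1) (vecCons a w) (vecCons 1 0) = a := by
  rw [diagQF_cons, tail_cons, QuadraticMap.map_zero, cons_val_zero]
  ring

lemma forall_cons_ne_zero {a : F} {w : Fin n → F} :
    (∀ i, vecCons a w i ≠ 0) ↔ a ≠ 0 ∧ ∀ i, w i ≠ 0 := by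
  simp [Fin.forall_fin_succ]

lemma polar_diagQF (w x y : Fin n → F) :
    QuadraticMap.polar (diagQF n w) x y = 2 * ∑ i, w i * x i * y i := by
  simp only [QuadraticMap.polar, diagQF_apply, ← Finset.sum_sub_distrib, Finset.mul_sum,
    Pi.add_apply]
  exact Finset.sum_congr rfl fun i _ => by ring

lemma QRep.of_linearMap {Q : QuadraticMap F (Fin n → F) F} {Q' : QuadraticMap F (Fin k → F) F}
    (f : (Fin k → F) →ₗ[F] (Fin n → F)) (hf : Function.Injective f)
    (h : ∀ x, Q (f x) = Q' x) : QRep Q Q' :=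
  ⟨⟨f, h⟩, hf⟩

lemma QRep.equivalent {Q Q' : QuadraticMap F (Fin n → F) F} (h : QRep Q Q') :
    Q'.Equivalent Q := by
  obtain ⟨f, hf⟩ := h
  exact ⟨⟨LinearEquiv.ofInjectiveEndo f.toLinearMap hf, f.map_app⟩⟩

lemma QRep.trans_equivalent {Q Q₁ : QuadraticMap F (Fin n → F) F}
    {Q' : QuadraticMap F (Fin k → F) F} (h : QRep Q Q') (e : Q.Equivalent Q₁) : QRep Q₁ Q' := by
  obtain ⟨f, hf⟩ := h
  obtain ⟨e⟩ := e
  exact ⟨e.toIsometry.comp f, e.injective.comp hf⟩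

lemma equivalent_comp_perm (w : Fin n → F) (σ : Equiv.Perm (Fin n)) :
    (diagQF n w).Equivalent (diagQF n (w ∘ σ)) := by
  refine ⟨⟨LinearEquiv.funCongrLeft F F σ, fun x => ?_⟩⟩
  simp only [diagQF_apply]
  exact Equiv.sum_comp σ (fun i => w i * x i ^ 2)

lemma equivalent_cons_swap (a b : F) (w : Fin n → F) :
    (diagQF (n + 2) (vecCons a (vecCons b w))).Equivalent
      (diagQF (n + 2) (vecCons b (vecCons a w))) := by
  convert equivalent_comp_perm (vecCons a (vecCons b w)) (Equiv.swap 0 1) using 2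
  ext i
  refine Fin.cases ?_ (fun i => Fin.cases ?_ (fun i => ?_) i) i
  · simp
  · simp
  · rw [Function.comp_apply, Equiv.swap_apply_of_ne_of_ne (Fin.succ_ne_zero _)
      (by rw [← Fin.succ_zero_eq_one, Ne, Fin.succ_inj]; exact Fin.succ_ne_zero i)]
    simp

lemma equivalent_cons {a b t : F} (ht : t ≠ 0) (h : a = b * t ^ 2) {w w' : Fin n → F}
    (e : (diagQF n w).Equivalent (diagQF n w')) :
    (diagQF (n + 1) (vecCons a w)).Equivalent (diagQF (n + 1) (vecCons b w')) := by
  obtain ⟨e⟩ := e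
  let f : (Fin (n + 1) → F) →ₗ[F] (Fin (n + 1) → F) :=
    { toFun := fun x => vecCons (t * x 0) (e (vecTail x))
      map_add' := fun x y => by
        rw [cons_add_cons, ← map_add, ← mul_add]
        rfl
      map_smul' := fun c x => by
        rw [RingHom.id_apply, smul_cons, ← map_smul, smul_eq_mul, mul_left_comm]
        rfl }
  have hf : ∀ x, f x = vecCons (t * x 0) (e (vecTail x)) := fun _ => rfl
  refine (QRep.of_linearMap f ?_ fun x => ?_).equivalent
  · intro x y hxy
    rw [hf, hf, vecCons_inj] at hxy
    rw [← cons_head_tail x, ← cons_head_tail y, e.injective hxy.2]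
    exact congrArg (vecCons · _) (mul_left_cancel₀ ht hxy.1)
  · rw [hf, diagQF_cons, diagQF_cons, tail_cons, e.map_app, h, cons_val_zero]
    ring

/-- A binary space representing `c ≠ 0` splits off `[c]`. -/
lemma equivalent_cons_cons {a b c x y : F} (hc : c ≠ 0)
    (h : c = a * x ^ 2 + b * y ^ 2) (w : Fin n → F) :
    (diagQF (n + 2) (vecCons a (vecCons b w))).Equivalent
      (diagQF (n + 2) (vecCons c (vecCons (a * b * c) w))) := by
  let f : (Fin (n + 2) → F) →ₗ[F] (Fin (n + 2) → F) :=
    { toFun := fun v => vecCons (v 0 * x - v 1 * (b * y))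
        (vecCons (v 0 * y + v 1 * (a * x)) (vecTail (vecTail v)))
      map_add' := fun u v => by
        rw [cons_add_cons, cons_add_cons]
        simp only [Pi.add_apply]
        ring_nf
        rfl
      map_smul' := fun r v => by
        rw [RingHom.id_apply, smul_cons, smul_cons]
        simp only [Pi.smul_apply, smul_eq_mul]
        ring_nf
        rfl }
  have hf : ∀ v, f v = vecCons (v 0 * x - v 1 * (b * y))
    (vecCons (v 0 * y + v 1 * (a * x)) (vecTail (vecTail v))) := fun _ => rfl
  symm
  refine (QRep.of_linearMap f ?_ fun v => ?_).equivalent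
  · rw [injective_iff_map_eq_zero]
    intro v hv
    rw [hf] at hv
    have h0 : v 0 * x - v 1 * (b * y) = 0 := congrFun hv 0
    have h1 : v 0 * y + v 1 * (a * x) = 0 := congrFun hv 1
    have h2 : ∀ i : Fin n, v i.succ.succ = 0 := fun i => congrFun hv i.succ.succ
    have e0 : v 0 = 0 := (mul_eq_zero.1 (show v 0 * c = 0 by
      linear_combination v 0 * h + a * x * h0 + b * y * h1)).resolve_right hc
    have e1 : v 1 = 0 := (mul_eq_zero.1 (show v 1 * c = 0 by
      linear_combination v 1 * h - y * h0 + x * h1)).resolve_right hc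
    ext i
    exact Fin.cases e0 (fun i => Fin.cases e1 h2 i) i
  · rw [hf]
    simp only [diagQF_cons, tail_cons, cons_val_zero]
    simp only [vecTail, Function.comp_apply, Fin.succ_zero_eq_one]
    linear_combination (-(v 0 ^ 2 + a * b * v 1 ^ 2)) * h

/-- A nondegenerate diagonal space representing `c ≠ 0` splits off `[c]`. -/
lemma exists_equivalent_cons {w : Fin (n + 1) → F} (hw : ∀ i, w i ≠ 0) {x : Fin (n + 1) → F}
    (hx : diagQF (n + 1) w x ≠ 0) : ∃ v : Fin n → F, (∀ i, v i ≠ 0) ∧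
      (diagQF (n + 1) w).Equivalent (diagQF (n + 1) (vecCons (diagQF (n + 1) w x) v)) := by
  induction n with
  | zero =>
    obtain ⟨a, v, rfl⟩ := exists_eq_cons w
    have h : diagQF 1 (vecCons a v) x = a * x 0 ^ 2 := by
      simp [diagQF_apply]
    rw [h] at hx ⊢
    have hx0 : x 0 ≠ 0 := by
      intro h0
      simp [h0] at hx
    exact ⟨v, fun i => i.elim0, (equivalent_cons hx0 rfl (.refl _)).symm⟩
  | succ n ih =>
    obtain ⟨a, v, rfl⟩ := exists_eq_cons w
    rw [forall_cons_ne_zero] at hw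
    have h := diagQF_cons a v x
    by_cases hd : diagQF (n + 1) v (vecTail x) = 0
    · rw [hd, add_zero] at h
      rw [h] at hx ⊢
      have hx0 : x 0 ≠ 0 := by
        intro h0
        simp [h0] at hx
      exact ⟨v, hw.2, (equivalent_cons hx0 rfl (.refl _)).symm⟩
    · obtain ⟨v', hv', e⟩ := ih hw.2 hd
      refine ⟨vecCons _ v', forall_cons_ne_zero.2
        ⟨mul_ne_zero (mul_ne_zero hw.1 hd) hx, hv'⟩, ?_⟩
      exact (equivalent_cons one_ne_zero (by ring) e).trans
        (equivalent_cons_cons hx (x := x 0) (y := 1) (by rw [h]; ring) v')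

end DiagonalForms

section WittCancellation

open Matrix QuadraticMap

variable [Field F]

lemma exists_isometryEquiv_of_map_sub_ne_zero {M : Type*} [AddCommGroup M] [Module F M]
    (Q : QuadraticMap F M F) {x y : M} (h : Q x = Q y) (hs : Q (x - y) ≠ 0) :
    ∃ f : Q.IsometryEquiv Q, f x = y := by
  set v := x - y with hv
  let f : M →ₗ[F] M := LinearMap.id - ((Q v)⁻¹ • Q.polarBilin v).smulRight v
  have hf : ∀ z, f z = z - ((Q v)⁻¹ * polar Q v z) • v := fun z => by simp [f]
  have hvv : polar Q v v = 2 * Q v := by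
    rw [polar_self, nsmul_eq_mul, Nat.cast_ofNat]
  have hff : ∀ z, f (f z) = z := by
    intro z
    rw [hf (f z), hf z, polar_sub_right, polar_smul_right, hvv, smul_eq_mul, sub_sub, ← add_smul]
    convert sub_zero z
    convert zero_smul F v
    field_simp
    ring
  have hQ : ∀ z, Q (f z) = Q z := by
    intro z
    rw [hf, sub_eq_add_neg, ← neg_smul, QuadraticMap.map_add Q, polar_smul_right,
      QuadraticMap.map_smul, polar_comm Q z v]
    simp only [smul_eq_mul]
    field_simp
    ring
  refine ⟨⟨LinearEquiv.ofInvolutive f hff, hQ⟩, ?_⟩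
  change f x = y
  have h1 : Q v = polar Q v x := by
    have : polar Q v x = 2 * Q x - polar Q x y := by
      rw [hv, polar_sub_left, polar_self, nsmul_eq_mul, Nat.cast_ofNat, polar_comm Q y x]
    rw [this, hv, sub_eq_add_neg, QuadraticMap.map_add Q, QuadraticMap.map_neg, polar_neg_right,
      ← h]
    ring
  rw [hf, ← h1, inv_mul_cancel₀ hs, one_smul, hv, sub_sub_cancel]

/-- Vectors of the same nonzero length are conjugate under the orthogonal group. -/
lemma exists_isometryEquiv_map_eq (h2 : (2 : F) ≠ 0) {M : Type*} [AddCommGroup M] [Module F M]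
    (Q : QuadraticMap F M F) {x y : M} (h : Q x = Q y) (hx : Q x ≠ 0) :
    ∃ f : Q.IsometryEquiv Q, f x = y := by
  by_cases hs : Q (x - y) = 0
  · have hs' : Q (x - -y) ≠ 0 := by
      intro hs'
      rw [sub_neg_eq_add, QuadraticMap.map_add Q] at hs'
      rw [sub_eq_add_neg, QuadraticMap.map_add Q, QuadraticMap.map_neg, polar_neg_right] at hs
      have : 2 * 2 * Q x = 0 := by linear_combination hs + hs' + 2 * h
      simp [h2, hx] at this
    obtain ⟨f, hf⟩ := exists_isometryEquiv_of_map_sub_ne_zero Q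
      (h.trans (QuadraticMap.map_neg Q y).symm) hs'
    refine ⟨f.trans ⟨LinearEquiv.neg F, QuadraticMap.map_neg Q⟩, ?_⟩
    change -(f x) = y
    rw [hf, neg_neg]
  · exact exists_isometryEquiv_of_map_sub_ne_zero Q h hs

variable {n k : ℕ}

lemma QRep.of_cons (h2 : (2 : F) ≠ 0) {a : F} (ha : a ≠ 0) {u : Fin n → F} {w : Fin k → F}
    (h : QRep (diagQF (n + 1) (vecCons a u)) (diagQF (k + 1) (vecCons a w))) :
    QRep (diagQF n u) (diagQF k w) := by
  obtain ⟨f, hf⟩ := h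
  obtain ⟨g, hg⟩ := exists_isometryEquiv_map_eq h2 (diagQF (n + 1) (vecCons a u))
    (x := f (vecCons 1 0)) (y := vecCons 1 0) (by rw [f.map_app, diagQF_cons_one_zero,
      diagQF_cons_one_zero])
    (by rwa [f.map_app, diagQF_cons_one_zero])
  let f' := g.toIsometry.comp f
  have hf' : f' (vecCons 1 0) = vecCons 1 0 := hg
  have hp : ∀ {m : ℕ} (v : Fin m → F) (x : Fin (m + 1) → F),
      polar (diagQF (m + 1) (vecCons a v)) (vecCons 1 0) x = 2 * a * x 0 := by
    intro m v x
    rw [polar_diagQF, Fin.sum_univ_succ]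
    simp
    ring
  have h0 : ∀ y : Fin k → F, f' (vecCons 0 y) 0 = 0 := by
    intro y
    have h1 := hp u (f' (vecCons 0 y))
    have h3 := hp w (vecCons 0 y)
    rw [polar, ← hf', ← map_add, f'.map_app, f'.map_app, f'.map_app, ← polar, h3,
      cons_val_zero, mul_zero] at h1
    simpa [h2, ha] using h1.symm
  let ι : (Fin k → F) →ₗ[F] (Fin (k + 1) → F) :=
    { toFun := fun y => vecCons 0 y
      map_add' := fun x y => by simp
      map_smul' := fun c x => by simp }
  let π : (Fin (n + 1) → F) →ₗ[F] (Fin n → F) := LinearMap.funLeft F F Fin.succ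
  have hπ : ∀ y, vecCons 0 (π (f' (ι y))) = f' (ι y) := by
    intro y
    rw [← h0 y]
    exact cons_head_tail _
  refine QRep.of_linearMap (π ∘ₗ f'.toLinearMap ∘ₗ ι) ?_ fun y => ?_
  · intro y z hyz
    have hyz' : π (f' (ι y)) = π (f' (ι z)) := hyz
    have h1 : f' (ι y) = f' (ι z) := by rw [← hπ, ← hπ z, hyz']
    exact (vecCons_inj.1 ((g.injective.comp hf) h1)).2
  · have h1 := f'.map_app (ι y)
    rw [← hπ, diagQF_cons, tail_cons, cons_val_zero] at h1
    change _ = diagQF (k + 1) (vecCons a w) (vecCons 0 y) at h1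
    rw [diagQF_cons, tail_cons, cons_val_zero] at h1
    simpa using h1

lemma QRep.of_equivalent {Q : QuadraticMap F (Fin n → F) F} {Q' : QuadraticMap F (Fin n → F) F}
    (h : Q'.Equivalent Q) : QRep Q Q' := by
  obtain ⟨e⟩ := h
  exact ⟨e.toIsometry, e.injective⟩

/-- Witt cancellation of a line. -/
lemma equivalent_of_equivalent_cons (h2 : (2 : F) ≠ 0) {a : F} (ha : a ≠ 0) {u w : Fin n → F}
    (h : (diagQF (n + 1) (vecCons a u)).Equivalent (diagQF (n + 1) (vecCons a w))) :
    (diagQF n u).Equivalent (diagQF n w) :=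
  ((QRep.of_equivalent h).of_cons h2 ha).equivalent

lemma QRep.exists_equivalent_cons_cons (h2 : (2 : F) ≠ 0) {u : Fin (n + 2) → F}
    (hu : ∀ i, u i ≠ 0) {w : Fin n → F} (hw : ∀ i, w i ≠ 0)
    (h : QRep (diagQF (n + 2) u) (diagQF n w)) : ∃ x y, x ≠ 0 ∧ y ≠ 0 ∧
      (diagQF (n + 2) u).Equivalent (diagQF (n + 2) (vecCons x (vecCons y w))) := by
  induction n with
  | zero =>
    obtain ⟨x, v, rfl⟩ := exists_eq_cons u
    obtain ⟨y, v, rfl⟩ := exists_eq_cons v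
    simp only [forall_cons_ne_zero] at hu
    refine ⟨x, y, hu.1, hu.2.1, ?_⟩
    rw [Subsingleton.elim v w]
  | succ n ih =>
    obtain ⟨a, w, rfl⟩ := exists_eq_cons w
    rw [forall_cons_ne_zero] at hw
    obtain ⟨f, hf⟩ := id h
    have hfa : diagQF (n + 3) u (f (vecCons 1 0)) = a := by
      rw [f.map_app, diagQF_cons_one_zero]
    obtain ⟨v, hv, e⟩ := exists_equivalent_cons hu (x := f (vecCons 1 0)) (by rw [hfa]; exact hw.1)
    rw [hfa] at e
    obtain ⟨x, y, hx, hy, e'⟩ := ih hv hw.2 ((h.trans_equivalent e).of_cons h2 hw.1)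
    refine ⟨x, y, hx, hy, e.trans ((equivalent_cons one_ne_zero (by ring) e').trans
      ((equivalent_cons_swap _ _ _).trans (equivalent_cons one_ne_zero (by ring)
        (equivalent_cons_swap _ _ _))))⟩

end WittCancellation

section HasseInvariant

open Matrix

variable [Field F]

/-- The Hilbert symbol, written additively. -/
def hilbertSym (a b : F) : ZMod 2 := if HilbertOne a b then 0 else 1

lemma hilbertSym_eq_zero {a b : F} : hilbertSym a b = 0 ↔ HilbertOne a b := by
  unfold hilbertSym
  split_ifs with h <;> simp [h]

lemma hilbertSym_eq_one {a b : F} : hilbertSym a b = 1 ↔ ¬ HilbertOne a b := by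
  unfold hilbertSym
  split_ifs with h <;> simp [h]

lemma hilbertSym_comm (a b : F) : hilbertSym a b = hilbertSym b a := by
  unfold hilbertSym
  simp only [hilbertOne_comm]

lemma hilbertSym_one (a : F) : hilbertSym a 1 = 0 :=
  hilbertSym_eq_zero.2 (by simpa using hilbertOne_sq (a := a) one_ne_zero)

lemma one_hilbertSym (a : F) : hilbertSym 1 a = 0 := by
  rw [hilbertSym_comm, hilbertSym_one]

/-- The Hasse invariant of the diagonal space `[w 0, …, w (n - 1)]`: the sum of the symbols
`(w i, w j)` over `i < j`. -/
def hasse : (n : ℕ) → (Fin n → F) → ZMod 2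
  | 0, _ => 0
  | n + 1, w => hilbertSym (vecHead w) (∏ i, vecTail w i) + hasse n (vecTail w)

variable {n : ℕ}

lemma hasse_cons (a : F) (w : Fin n → F) :
    hasse (n + 1) (vecCons a w) = hilbertSym a (∏ i, w i) + hasse n w := rfl

lemma prod_cons (a : F) (w : Fin n → F) : ∏ i, vecCons a w i = a * ∏ i, w i := by
  simp [Fin.prod_univ_succ]

lemma prod_ne_zero {w : Fin n → F} (hw : ∀ i, w i ≠ 0) : ∏ i, w i ≠ 0 :=
  Finset.prod_ne_zero_iff.2 fun i _ => hw i

lemma zmod_two_add_self (a : ZMod 2) : a + a = 0 := CharTwo.add_self_eq_zero a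

namespace HasHilbertSymbol

variable (H : HasHilbertSymbol F)

include H

lemma sym_mul_right {a b c : F} (ha : a ≠ 0) (hb : b ≠ 0) (hc : c ≠ 0) :
    hilbertSym a (b * c) = hilbertSym a b + hilbertSym a c := by
  have h2 := H.two_ne_zero
  by_cases hab : HilbertOne a b
  · rw [hilbertSym_eq_zero.2 hab, zero_add]
    by_cases hac : HilbertOne a c
    · rw [hilbertSym_eq_zero.2 hac, hilbertSym_eq_zero]
      exact hab.mul_right h2 ha hb hc hac
    · rw [hilbertSym_eq_one.2 hac, hilbertSym_eq_one]
      exact fun h => hac (hab.of_mul_right h2 ha hb hc h)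
  · by_cases hac : HilbertOne a c
    · rw [hilbertSym_eq_one.2 hab, hilbertSym_eq_zero.2 hac, add_zero, hilbertSym_eq_one]
      rw [mul_comm]
      exact fun h => hab (hac.of_mul_right h2 ha hc hb h)
    · rw [hilbertSym_eq_one.2 hab, hilbertSym_eq_one.2 hac, zmod_two_add_self, hilbertSym_eq_zero]
      exact H.mul_of_not a b c ha hb hc hab hac

lemma sym_mul_left {a b c : F} (ha : a ≠ 0) (hb : b ≠ 0) (hc : c ≠ 0) :
    hilbertSym (a * b) c = hilbertSym a c + hilbertSym b c := by
  rw [hilbertSym_comm, H.sym_mul_right hc ha hb, hilbertSym_comm c, hilbertSym_comm c]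

lemma sym_self {a : F} (ha : a ≠ 0) : hilbertSym a a = hilbertSym a (-1) := by
  have h := hilbertSym_eq_zero.2 (hilbertOne_neg_self H.two_ne_zero ha)
  rw [← neg_one_mul, H.sym_mul_right ha (neg_ne_zero.2 one_ne_zero) ha] at h
  exact (CharTwo.add_eq_zero.1 h).symm

lemma sym_neg_right {a b : F} (ha : a ≠ 0) (hb : b ≠ 0) :
    hilbertSym a (-b) = hilbertSym a (-1) + hilbertSym a b := by
  rw [← neg_one_mul, H.sym_mul_right ha (neg_ne_zero.2 one_ne_zero) hb]

lemma isSquare_iff {a : F} (ha : a ≠ 0) : IsSquare a ↔ ∀ b, b ≠ 0 → hilbertSym a b = 0 := by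
  constructor
  · rintro ⟨t, rfl⟩ b -
    rw [hilbertSym_eq_zero, ← pow_two, hilbertOne_comm]
    exact hilbertOne_sq (left_ne_zero_of_mul ha)
  · intro h
    by_contra hs
    obtain ⟨b, hb, hab⟩ := H.exists_not a ha hs
    exact hab (hilbertSym_eq_zero.1 (h b hb))

lemma isSquare_mul_iff {a b : F} (ha : a ≠ 0) (hb : b ≠ 0) :
    IsSquare (a * b) ↔ ∀ c, c ≠ 0 → hilbertSym a c = hilbertSym b c := by
  rw [H.isSquare_iff (mul_ne_zero ha hb)]
  refine forall₂_congr fun c hc => ?_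
  rw [H.sym_mul_left ha hb hc, CharTwo.add_eq_zero]

/-- The binary space `[a, b]` represents `c` iff `(c, -ab) = (a, b)`. -/
lemma exists_eq_iff {a b c : F} (ha : a ≠ 0) (hb : b ≠ 0) (hc : c ≠ 0) :
    (∃ x y, c = a * x ^ 2 + b * y ^ 2) ↔ hilbertSym c (-(a * b)) = hilbertSym a b := by
  have h : (∃ x y, c = a * x ^ 2 + b * y ^ 2) ↔ HilbertOne (a * c) (b * c) := by
    constructor
    · rintro ⟨x, y, h⟩
      refine ⟨x / c, y / c, ?_⟩
      field_simp
      exact h.symm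
    · rintro ⟨x, y, h⟩
      exact ⟨c * x, c * y, by linear_combination (-c) * h⟩
  rw [h, ← hilbertSym_eq_zero, H.sym_mul_left ha hc (mul_ne_zero hb hc), H.sym_mul_right ha hb hc,
    H.sym_mul_right hc hb hc, H.sym_self hc, H.sym_neg_right hc (mul_ne_zero ha hb),
    H.sym_mul_right hc ha hb, hilbertSym_comm a c]
  generalize hilbertSym c a = p, hilbertSym c b = q, hilbertSym a b = r, hilbertSym c (-1) = s
  revert p q r s
  decide

lemma sym_eq_of_eq {a b c x y : F} (ha : a ≠ 0) (hb : b ≠ 0) (hc : c ≠ 0)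
    (h : c = a * x ^ 2 + b * y ^ 2) : hilbertSym c (a * b * c) = hilbertSym a b := by
  rw [← (H.exists_eq_iff ha hb hc).1 ⟨x, y, h⟩, H.sym_mul_right hc (mul_ne_zero ha hb) hc,
    H.sym_self hc, H.sym_neg_right hc (mul_ne_zero ha hb), add_comm]

/-- The discriminant and the Hasse invariant are isometry invariants. -/
lemma invariants_of_equivalent {w w' : Fin n → F} (hw : ∀ i, w i ≠ 0) (hw' : ∀ i, w' i ≠ 0)
    (h : (diagQF n w).Equivalent (diagQF n w')) :
    (∀ c, c ≠ 0 → hilbertSym (∏ i, w i) c = hilbertSym (∏ i, w' i) c) ∧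
      hasse n w = hasse n w' := by
  induction n with
  | zero => simp [hasse]
  | succ n ih =>
    obtain ⟨a, w, rfl⟩ := exists_eq_cons w
    obtain ⟨b, w', rfl⟩ := exists_eq_cons w'
    rw [forall_cons_ne_zero] at hw hw'
    obtain ⟨ha, hw⟩ := hw
    obtain ⟨hb, hw'⟩ := hw'
    have hW := prod_ne_zero hw
    have hW' := prod_ne_zero hw'
    obtain ⟨e⟩ := id h
    have hx : b = a * e.symm (vecCons 1 0) 0 ^ 2 + diagQF n w (vecTail (e.symm (vecCons 1 0))) := by
      rw [← diagQF_cons, e.symm.map_app, diagQF_cons_one_zero]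
    set x := e.symm (vecCons 1 0)
    by_cases hd : diagQF n w (vecTail x) = 0
    · rw [hd, add_zero] at hx
      have hx0 : x 0 ≠ 0 := by
        rintro h0
        simp [h0] at hx
        exact hb hx
      have hab : ∀ c, c ≠ 0 → hilbertSym a c = hilbertSym b c :=
        (H.isSquare_mul_iff ha hb).1 ⟨a * x 0, by rw [hx]; ring⟩
      obtain ⟨h1, h2⟩ := ih hw hw' (equivalent_of_equivalent_cons H.two_ne_zero hb
        ((equivalent_cons hx0 hx (.refl _)).trans h))
      simp only [prod_cons, hasse_cons]
      refine ⟨fun c hc => ?_, ?_⟩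
      · rw [H.sym_mul_left ha hW hc, H.sym_mul_left hb hW' hc, hab c hc, h1 c hc]
      · rw [h2, hab _ hW, hilbertSym_comm, h1 b hb, hilbertSym_comm]
    · cases n with
      | zero => exact absurd (by simp [diagQF_apply]) hd
      | succ n =>
        obtain ⟨v, hv, e'⟩ := exists_equivalent_cons hw hd
        set c := diagQF (n + 1) w (vecTail x)
        have hV := prod_ne_zero hv
        have habc := mul_ne_zero (mul_ne_zero ha hd) hb
        have hb1 : b = a * x 0 ^ 2 + c * 1 ^ 2 := by
          rw [hx]
          ring
        obtain ⟨h1, h2⟩ := ih hw (forall_cons_ne_zero.2 ⟨hd, hv⟩) e'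
        obtain ⟨h3, h4⟩ := ih hw' (forall_cons_ne_zero.2 ⟨habc, hv⟩)
          (equivalent_of_equivalent_cons H.two_ne_zero hb (h.symm.trans
            ((equivalent_cons one_ne_zero (by ring) e').trans (equivalent_cons_cons hb hb1 v))))
        simp only [prod_cons, hasse_cons] at h1 h2 h3 h4 ⊢
        have h5 := H.sym_eq_of_eq ha hd hb hb1
        refine ⟨fun d hd' => ?_, ?_⟩
        · rw [H.sym_mul_left ha hW hd', H.sym_mul_left hb hW' hd', h1 d hd', h3 d hd',
            H.sym_mul_left habc hV hd', H.sym_mul_left hd hV hd',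
            H.sym_mul_left (mul_ne_zero ha hd) hb hd', H.sym_mul_left ha hd hd']
          generalize hilbertSym a d = p, hilbertSym c d = q, hilbertSym b d = r,
            hilbertSym (∏ i, v i) d = s
          revert p q r s
          decide
        · rw [h2, h4, hilbertSym_comm a, h1 a ha, hilbertSym_comm b, h3 b hb,
            hilbertSym_comm _ a, hilbertSym_comm _ b, H.sym_mul_right ha hd hV,
            H.sym_mul_right hb habc hV, h5, H.sym_mul_left (mul_ne_zero ha hd) hb hV,
            H.sym_mul_left ha hd hV]
          generalize hilbertSym a c = p, hilbertSym c (∏ i, v i) = q, hilbertSym b (∏ i, v i) = r,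
            hilbertSym a (∏ i, v i) = s, hasse n v = t
          revert p q r s t
          decide

lemma exists_sym_eq {a : F} (ha : a ≠ 0) (hs : ¬ IsSquare a) (s : ZMod 2) :
    ∃ t, t ≠ 0 ∧ hilbertSym t a = s := by
  obtain ⟨t, ht, hat⟩ := H.exists_not a ha hs
  rw [hilbertOne_comm, ← hilbertSym_eq_one] at hat
  have : s = 0 ∨ s = 1 := by
    revert s
    decide
  rcases this with rfl | rfl
  · exact ⟨1, one_ne_zero, one_hilbertSym a⟩
  · exact ⟨t, ht, hat⟩

lemma sym_pow_left {a b : F} (ha : a ≠ 0) (hb : b ≠ 0) (k : ℕ) :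
    hilbertSym (a ^ k) b = k * hilbertSym a b := by
  induction k with
  | zero => simp [one_hilbertSym]
  | succ k ih =>
    rw [pow_succ, H.sym_mul_left (pow_ne_zero k ha) ha hb, ih]
    push_cast
    ring

lemma exists_sym_eq_and_sym_eq {a b : F} (ha : a ≠ 0) (hb : b ≠ 0) (hab : ¬ IsSquare (a * b))
    {p q : ZMod 2} (hp : IsSquare a → p = 0) (hq : IsSquare b → q = 0) :
    ∃ t, t ≠ 0 ∧ hilbertSym t a = p ∧ hilbertSym t b = q := by
  by_cases ha' : IsSquare a
  · obtain ⟨t, ht, h⟩ := H.exists_sym_eq hb (fun hb' => hab (ha'.mul hb')) q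
    exact ⟨t, ht, by rw [hp ha', hilbertSym_comm, (H.isSquare_iff ha).1 ha' t ht], h⟩
  by_cases hb' : IsSquare b
  · obtain ⟨t, ht, h⟩ := H.exists_sym_eq ha ha' p
    exact ⟨t, ht, h, by rw [hq hb', hilbertSym_comm, (H.isSquare_iff hb).1 hb' t ht]⟩
  obtain ⟨x, hx, hxa⟩ := H.exists_sym_eq ha ha' 1
  obtain ⟨y, hy, hyb⟩ := H.exists_sym_eq hb hb' 1
  obtain ⟨z, hz, hzab⟩ := H.exists_sym_eq (mul_ne_zero ha hb) hab 1
  rw [H.sym_mul_right hz ha hb] at hzab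
  have key : ∀ p q x y z z' : ZMod 2, z + z' = 1 → ∃ i j k : Fin 2,
      (i.val * 1 + j.val * y + k.val * z : ZMod 2) = p ∧
      (i.val * x + j.val * 1 + k.val * z' : ZMod 2) = q := by
    decide
  obtain ⟨i, j, k, h1, h2⟩ := key p q (hilbertSym x b) (hilbertSym y a) _ _ hzab
  have hxi := pow_ne_zero i.val hx
  have hyj := pow_ne_zero j.val hy
  have hzk := pow_ne_zero k.val hz
  refine ⟨x ^ i.val * y ^ j.val * z ^ k.val, mul_ne_zero (mul_ne_zero hxi hyj) hzk, ?_, ?_⟩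
  · rw [← h1, H.sym_mul_left (mul_ne_zero hxi hyj) hzk ha, H.sym_mul_left hxi hyj ha,
      H.sym_pow_left hx ha, H.sym_pow_left hy ha, H.sym_pow_left hz ha, hxa]
  · rw [← h2, H.sym_mul_left (mul_ne_zero hxi hyj) hzk hb, H.sym_mul_left hxi hyj hb,
      H.sym_pow_left hx hb, H.sym_pow_left hy hb, H.sym_pow_left hz hb, hyb]

/-- A ternary space `[a, b, c]` represents every `e` outside the square class of `-abc`. -/
lemma exists_eq_ternary {a b c e : F} (ha : a ≠ 0) (hb : b ≠ 0) (hc : c ≠ 0) (he : e ≠ 0)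
    (h : ¬ IsSquare (-(a * b * c) * e)) : ∃ x y z, e = a * x ^ 2 + b * y ^ 2 + c * z ^ 2 := by
  have hab := neg_ne_zero.2 (mul_ne_zero ha hb)
  have hec := mul_ne_zero he hc
  obtain ⟨t, ht, h1, h2⟩ := H.exists_sym_eq_and_sym_eq hab hec
    (by rwa [show -(a * b) * (e * c) = -(a * b * c) * e by ring])
    (p := hilbertSym a b) (q := hilbertSym e (-c))
    (fun hs => by
      have h := (H.isSquare_iff hab).1 hs a ha
      rw [hilbertSym_comm, H.sym_neg_right ha (mul_ne_zero ha hb), H.sym_mul_right ha ha hb,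
        H.sym_self ha, ← add_assoc, zmod_two_add_self, zero_add] at h
      exact h)
    (fun hs => by
      have h := (H.isSquare_iff hec).1 hs e he
      rw [hilbertSym_comm, H.sym_mul_right he he hc, H.sym_self he] at h
      rw [H.sym_neg_right he hc, h])
  obtain ⟨x, y, hxy⟩ := (H.exists_eq_iff ha hb ht).2 h1
  obtain ⟨r, z, hrz⟩ := (H.exists_eq_iff ht hc he).2 (by
    rw [H.sym_neg_right he (mul_ne_zero ht hc), H.sym_mul_right he ht hc]
    rw [H.sym_mul_right ht he hc, H.sym_neg_right he hc] at h2
    rw [hilbertSym_comm e t]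
    revert h2
    generalize hilbertSym t e = p, hilbertSym t c = q, hilbertSym e (-1) = r, hilbertSym e c = s
    revert p q r s
    decide)
  exact ⟨x * r, y * r, z, by rw [hrz, hxy]; ring⟩

lemma exists_not_isSquare_mul {a b : F} (ha : a ≠ 0) (hb : b ≠ 0) :
    ∃ e, e ≠ 0 ∧ ¬ IsSquare (a * e) ∧ ¬ IsSquare (b * e) := by
  obtain ⟨p, q, hp, hq, hpq⟩ := H.exists_indep
  have hp0 : p ≠ 0 := by
    rintro rfl
    exact hp .zero
  have hq0 : q ≠ 0 := by
    rintro rfl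
    exact hq .zero
  have key : ∀ {d x y : F}, d ≠ 0 → IsSquare (d * x) → IsSquare (d * y) → IsSquare (x * y) := by
    rintro d x y hd ⟨s, hs⟩ ⟨t, ht⟩
    refine ⟨s * t / d, ?_⟩
    field_simp
    linear_combination (d * y) * hs + s * s * ht
  have key' : ∀ {d : F}, d ≠ 0 → IsSquare (d * 1) → ¬ IsSquare (d * p) ∧ ¬ IsSquare (d * q) :=
    fun hd h => ⟨fun h' => hp (by simpa using key hd h h'),
      fun h' => hq (by simpa using key hd h h')⟩
  by_cases ha1 : IsSquare (a * 1)
  · obtain ⟨hap, haq⟩ := key' ha ha1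
    by_cases hbp : IsSquare (b * p)
    · exact ⟨q, hq0, haq, fun h => hpq (key hb hbp h)⟩
    · exact ⟨p, hp0, hap, hbp⟩
  · by_cases hb1 : IsSquare (b * 1)
    · obtain ⟨hbp, hbq⟩ := key' hb hb1
      by_cases hap : IsSquare (a * p)
      · exact ⟨q, hq0, fun h => hpq (key ha hap h), hbq⟩
      · exact ⟨p, hp0, hap, hbp⟩
    · exact ⟨1, one_ne_zero, ha1, hb1⟩

lemma exists_diagQF_eq_diagQF {w w' : Fin (n + 1) → F} (hw : ∀ i, w i ≠ 0)
    (hw' : ∀ i, w' i ≠ 0)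
    (h : ∀ c, c ≠ 0 → hilbertSym (∏ i, w i) c = hilbertSym (∏ i, w' i) c)
    (hh : hasse (n + 1) w = hasse (n + 1) w') :
    ∃ x y, diagQF (n + 1) w x ≠ 0 ∧ diagQF (n + 1) w x = diagQF (n + 1) w' y := by
  match n with
  | 0 =>
    obtain ⟨a, v, rfl⟩ := exists_eq_cons w
    obtain ⟨b, v', rfl⟩ := exists_eq_cons w'
    rw [forall_cons_ne_zero] at hw hw'
    simp only [prod_cons, Finset.univ_eq_empty, Finset.prod_empty, mul_one] at h
    obtain ⟨t, ht⟩ := (H.isSquare_mul_iff hw.1 hw'.1).2 h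
    refine ⟨vecCons 1 0, vecCons (t / b) 0, ?_, ?_⟩
    · rw [diagQF_cons_one_zero]
      exact hw.1
    · have hb := hw'.1
      rw [diagQF_cons_one_zero, diagQF_cons, tail_cons, QuadraticMap.map_zero, cons_val_zero]
      field_simp
      linear_combination ht
  | 1 =>
    obtain ⟨a, v, rfl⟩ := exists_eq_cons w
    obtain ⟨b, v, rfl⟩ := exists_eq_cons v
    obtain ⟨c, v', rfl⟩ := exists_eq_cons w'
    obtain ⟨d, v', rfl⟩ := exists_eq_cons v'
    simp only [forall_cons_ne_zero] at hw hw'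
    obtain ⟨ha, hb, -⟩ := hw
    obtain ⟨hc, hd, -⟩ := hw'
    simp only [prod_cons, hasse_cons] at h hh
    simp only [Finset.univ_eq_empty, Finset.prod_empty, mul_one, hilbertSym_one, hasse,
      add_zero] at h hh
    obtain ⟨x, y, hxy⟩ := (H.exists_eq_iff ha hb hc).2 (by
      rw [H.sym_neg_right hc (mul_ne_zero ha hb), hilbertSym_comm c (a * b), h c hc,
        hilbertSym_comm _ c, H.sym_mul_right hc hc hd, H.sym_self hc, ← add_assoc,
        zmod_two_add_self, zero_add, hh])
    have e : diagQF 2 (vecCons a (vecCons b v)) ![x, y] = c := by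
      rw [hxy]
      simp [diagQF_apply]
    refine ⟨![x, y], vecCons 1 0, by rwa [e], ?_⟩
    rw [e, diagQF_cons_one_zero]
  | n + 2 =>
    have key : ∀ w : Fin (n + 3) → F, (∀ i, w i ≠ 0) → ∃ d, d ≠ 0 ∧ ∀ e, e ≠ 0 →
        ¬ IsSquare (d * e) → ∃ x, diagQF (n + 3) w x = e := by
      intro w hw
      obtain ⟨a, v, rfl⟩ := exists_eq_cons w
      obtain ⟨b, v, rfl⟩ := exists_eq_cons v
      obtain ⟨c, v, rfl⟩ := exists_eq_cons v
      simp only [forall_cons_ne_zero] at hw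
      obtain ⟨ha, hb, hc, -⟩ := hw
      refine ⟨-(a * b * c), neg_ne_zero.2 (mul_ne_zero (mul_ne_zero ha hb) hc),
        fun e he h => ?_⟩
      obtain ⟨x, y, z, hxyz⟩ := H.exists_eq_ternary ha hb hc he h
      refine ⟨vecCons x (vecCons y (vecCons z 0)), ?_⟩
      simp only [diagQF_cons, tail_cons, QuadraticMap.map_zero, cons_val_zero, hxyz]
      ring
    obtain ⟨d, hd, hwd⟩ := key w hw
    obtain ⟨d', hd', hwd'⟩ := key w' hw'
    obtain ⟨e, he, h1, h2⟩ := H.exists_not_isSquare_mul hd hd'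
    obtain ⟨x, hx⟩ := hwd e he h1
    obtain ⟨y, hy⟩ := hwd' e he h2
    exact ⟨x, y, by rwa [hx], hx.trans hy.symm⟩

/-- The discriminant and the Hasse invariant classify quadratic spaces of a given dimension. -/
lemma equivalent_of_invariants {w w' : Fin n → F} (hw : ∀ i, w i ≠ 0) (hw' : ∀ i, w' i ≠ 0)
    (h : ∀ c, c ≠ 0 → hilbertSym (∏ i, w i) c = hilbertSym (∏ i, w' i) c)
    (hh : hasse n w = hasse n w') : (diagQF n w).Equivalent (diagQF n w') := by
  induction n with
  | zero =>
    rw [Subsingleton.elim w w']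
  | succ n ih =>
    obtain ⟨x, y, hx, hxy⟩ := H.exists_diagQF_eq_diagQF hw hw' h hh
    obtain ⟨v, hv, e⟩ := exists_equivalent_cons hw hx
    obtain ⟨v', hv', e'⟩ := exists_equivalent_cons hw' (hxy ▸ hx)
    rw [← hxy] at e'
    set a := diagQF (n + 1) w x
    obtain ⟨h1, h2⟩ := H.invariants_of_equivalent hw (forall_cons_ne_zero.2 ⟨hx, hv⟩) e
    obtain ⟨h3, h4⟩ := H.invariants_of_equivalent hw' (forall_cons_ne_zero.2 ⟨hx, hv'⟩) e'
    simp only [prod_cons, hasse_cons] at h1 h2 h3 h4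
    have hV : ∀ c, c ≠ 0 → hilbertSym (∏ i, v i) c = hilbertSym (∏ i, v' i) c := by
      intro c hc
      have := h c hc
      rw [h1 c hc, h3 c hc, H.sym_mul_left hx (prod_ne_zero hv) hc,
        H.sym_mul_left hx (prod_ne_zero hv') hc] at this
      exact add_left_cancel this
    refine e.trans ((equivalent_cons one_ne_zero (by ring) (ih hv hv' hV ?_)).trans e'.symm)
    rw [h2, h4, hilbertSym_comm, hV a hx, hilbertSym_comm] at hh
    exact add_left_cancel hh

lemma equivalent_iff {w w' : Fin n → F} (hw : ∀ i, w i ≠ 0) (hw' : ∀ i, w' i ≠ 0) :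
    (diagQF n w).Equivalent (diagQF n w') ↔
      IsSquare ((∏ i, w i) * ∏ i, w' i) ∧ hasse n w = hasse n w' := by
  rw [H.isSquare_mul_iff (prod_ne_zero hw) (prod_ne_zero hw')]
  exact ⟨H.invariants_of_equivalent hw hw', fun h => H.equivalent_of_invariants hw hw' h.1 h.2⟩

lemma hasse_cons_cons {x y : F} (hx : x ≠ 0) (hy : y ≠ 0) {w : Fin n → F} (hw : ∀ i, w i ≠ 0) :
    hasse (n + 2) (vecCons x (vecCons y w)) =
      hilbertSym x y + hilbertSym (x * y) (∏ i, w i) + hasse n w := by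
  have hW := prod_ne_zero hw
  rw [hasse_cons, hasse_cons, prod_cons, H.sym_mul_right hx hy hW, H.sym_mul_left hx hy hW]
  ring

/-- An `(n + 2)`-dimensional space represents every `n`-dimensional space, except that in the
case of opposite discriminants the complement has to be a hyperbolic plane. -/
lemma qrep_iff {u : Fin (n + 2) → F} {w : Fin n → F} (hu : ∀ i, u i ≠ 0) (hw : ∀ i, w i ≠ 0) :
    QRep (diagQF (n + 2) u) (diagQF n w) ↔
      (IsSquare (-((∏ i, u i) * ∏ i, w i)) →
        hasse (n + 2) u = hilbertSym (-1) (∏ i, w i) + hasse n w) := by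
  have hU := prod_ne_zero hu
  have hW := prod_ne_zero hw
  have h1 : (-1 : F) ≠ 0 := neg_ne_zero.2 one_ne_zero
  have of_equivalent : ∀ x y, (diagQF (n + 2) (vecCons x (vecCons y w))).Equivalent
      (diagQF (n + 2) u) → QRep (diagQF (n + 2) u) (diagQF n w) := by
    intro x y e
    refine QRep.trans_equivalent (QRep.of_linearMap
      { toFun := fun z => vecCons 0 (vecCons 0 z)
        map_add' := fun a b => by simp
        map_smul' := fun c a => by simp } (fun a b h => ?_) fun z => ?_) e
    · exact (vecCons_inj.1 (vecCons_inj.1 h).2).2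
    · simp [diagQF_cons]
  constructor
  · intro h hs
    obtain ⟨x, y, hx, hy, e⟩ := h.exists_equivalent_cons_cons H.two_ne_zero hu hw
    obtain ⟨h3, h4⟩ := H.invariants_of_equivalent hu
      (forall_cons_ne_zero.2 ⟨hx, forall_cons_ne_zero.2 ⟨hy, hw⟩⟩) e
    rw [H.hasse_cons_cons hx hy hw] at h4
    have hxy : ∀ c, c ≠ 0 → hilbertSym (x * y) c = hilbertSym (-1) c := by
      intro c hc
      have h5 := (H.isSquare_iff (neg_ne_zero.2 (mul_ne_zero hU hW))).1 hs c hc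
      rw [← neg_one_mul, H.sym_mul_left h1 (mul_ne_zero hU hW) hc, H.sym_mul_left hU hW hc,
        h3 c hc, prod_cons, prod_cons, ← mul_assoc,
        H.sym_mul_left (mul_ne_zero hx hy) hW hc] at h5
      revert h5
      generalize hilbertSym (x * y) c = p, hilbertSym (-1) c = q, hilbertSym (∏ i, w i) c = r
      revert p q r
      decide
    have h6 := hxy x hx
    rw [H.sym_mul_left hx hy hx, H.sym_self hx, hilbertSym_comm y x, hilbertSym_comm (-1) x,
      add_eq_left] at h6
    rw [h4, h6, hxy _ hW, zero_add]
  · intro h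
    set e := (∏ i, u i) * ∏ i, w i with he
    have he0 : e ≠ 0 := mul_ne_zero hU hW
    obtain ⟨x, hx, hxe⟩ : ∃ x, x ≠ 0 ∧
        hasse (n + 2) u = hilbertSym x (-e) + hilbertSym e (∏ i, w i) + hasse n w := by
      by_cases hs : IsSquare (-e)
      · refine ⟨1, one_ne_zero, ?_⟩
        rw [h hs, one_hilbertSym, zero_add, (H.isSquare_mul_iff h1 he0).1 (by simpa) _ hW]
      · obtain ⟨x, hx, h⟩ := H.exists_sym_eq (neg_ne_zero.2 he0) hs
          (hasse (n + 2) u + hilbertSym e (∏ i, w i) + hasse n w)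
        refine ⟨x, hx, ?_⟩
        rw [h]
        generalize hasse (n + 2) u = p, hilbertSym e (∏ i, w i) = q, hasse n w = r
        revert p q r
        decide
    have hex := mul_ne_zero he0 hx
    refine of_equivalent x (e * x) (H.equivalent_of_invariants
      (forall_cons_ne_zero.2 ⟨hx, forall_cons_ne_zero.2 ⟨hex, hw⟩⟩) hu (fun c hc => ?_) ?_)
    · have hcW := H.sym_mul_left hU hW hc
      rw [prod_cons, prod_cons, H.sym_mul_left hx (mul_ne_zero hex hW) hc,
        H.sym_mul_left hex hW hc, H.sym_mul_left he0 hx hc, hcW]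
      generalize hilbertSym x c = p, hilbertSym (∏ i, u i) c = q, hilbertSym (∏ i, w i) c = r
      revert p q r
      decide
    · rw [H.hasse_cons_cons hx hex hw, hxe, H.sym_mul_right hx he0 hx, H.sym_self hx,
        H.sym_neg_right hx he0, H.sym_mul_left hx hex hW, H.sym_mul_left he0 hx hW]
      generalize hilbertSym x e = p, hilbertSym x (-1) = q, hilbertSym x (∏ i, w i) = r,
        hilbertSym e (∏ i, w i) = s, hasse n w = t
      revert p q r s t
      decide

lemma exists_sym (s : ZMod 2) : ∃ p q : F, p ≠ 0 ∧ q ≠ 0 ∧ hilbertSym p q = s := by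
  obtain ⟨a, -, ha, -⟩ := H.exists_indep
  have ha0 : a ≠ 0 := by
    rintro rfl
    exact ha .zero
  obtain ⟨t, ht, h⟩ := H.exists_sym_eq ha0 ha s
  exact ⟨t, a, ht, ha0, h⟩

/-- In dimension at least three every pair of invariants occurs. -/
lemma exists_invariants (n : ℕ) {d : F} (hd : d ≠ 0) (s : ZMod 2) :
    ∃ u : Fin (n + 3) → F, (∀ i, u i ≠ 0) ∧ (∃ t, t ≠ 0 ∧ ∏ i, u i = d * t ^ 2) ∧
      hasse (n + 3) u = s := by
  have h1 : (-1 : F) ≠ 0 := neg_ne_zero.2 one_ne_zero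
  have ones : ∀ n : ℕ, hasse n (1 : Fin n → F) = 0 := by
    intro n
    induction n with
    | zero => rfl
    | succ n ih =>
      change hilbertSym 1 _ + hasse n (1 : Fin n → F) = 0
      rw [one_hilbertSym, ih, add_zero]
  obtain ⟨p, q, hp, hq, hpq⟩ := H.exists_sym (s + hilbertSym (-1 * d) (-1))
  have hdp := mul_ne_zero hd hp
  have hdq := mul_ne_zero hd hq
  have hr := mul_ne_zero hd (mul_ne_zero hp hq)
  refine ⟨vecCons (-(d * p)) (vecCons (-(d * q)) (vecCons (d * (p * q)) 1)), ?_, ?_, ?_⟩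
  · simp only [forall_cons_ne_zero]
    exact ⟨neg_ne_zero.2 hdp, neg_ne_zero.2 hdq, hr, fun _ => one_ne_zero⟩
  · refine ⟨d * p * q, mul_ne_zero hdp hq, ?_⟩
    simp only [prod_cons, Pi.one_apply, Finset.prod_const_one]
    ring
  · simp only [hasse_cons, prod_cons, Pi.one_apply, Finset.prod_const_one, mul_one,
      hilbertSym_one, ones, add_zero]
    rw [← neg_one_mul (d * p), ← neg_one_mul (d * q)]
    simp only [H.sym_mul_left, H.sym_mul_right, ne_eq, mul_eq_zero, hd, hp, hq, h1,
      or_self, not_false_eq_true, H.sym_self hd, H.sym_self hp, H.sym_self hq,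
      hilbertSym_comm (-1) d, hilbertSym_comm (-1) p, hilbertSym_comm (-1) q,
      hilbertSym_comm q d, hilbertSym_comm q p, hilbertSym_comm p d] at hpq ⊢
    revert hpq
    generalize hilbertSym p q = x₁, hilbertSym d p = x₂, hilbertSym d q = x₃,
      hilbertSym d (-1) = x₄, hilbertSym p (-1) = x₅, hilbertSym q (-1) = x₆,
      hilbertSym (-1 : F) (-1) = x₇
    clear * -
    revert x₁ x₂ x₃ x₄ x₅ x₆ x₇ s
    decide

end HasHilbertSymbol

end HasseInvariant

/-- for every `n`-dimensional quadratic space `W` (diagonalized by `w`),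
there is, up to isometry, exactly one `(n+2)`-dimensional space `V` representing every
`n`-dimensional space except `W`; explicitly, `V` has determinant `-det W` and is the
class not isometric to `W ⊥ ℍ`. -/
theorem exists_unique_complement_space [Field F] [Algebra ℚ_[2] F]
    [FiniteDimensional ℚ_[2] F] (n : ℕ) (hn : 2 ≤ n)
    (w : Fin n → F) (hw : ∀ i, w i ≠ 0) :
    ∃ u : Fin (n + 2) → F, (∀ i, u i ≠ 0) ∧
      (∀ w' : Fin n → F, (∀ i, w' i ≠ 0) →
        (QRep (diagQF (n + 2) u) (diagQF n w') ↔
          ¬ QuadraticMap.Equivalent (diagQF n w') (diagQF n w))) ∧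
      (∀ u' : Fin (n + 2) → F, (∀ i, u' i ≠ 0) →
        (∀ w' : Fin n → F, (∀ i, w' i ≠ 0) →
          (QRep (diagQF (n + 2) u') (diagQF n w') ↔
            ¬ QuadraticMap.Equivalent (diagQF n w') (diagQF n w))) →
        QuadraticMap.Equivalent (diagQF (n + 2) u') (diagQF (n + 2) u)) ∧
      (∃ t : F, t ≠ 0 ∧ (∏ i, u i) = -(∏ i, w i) * t ^ 2) ∧
      ¬ QuadraticMap.Equivalent (diagQF (n + 2) u)
          (diagQF (n + 2) (Fin.append w ![1, -1])) := by
  have H := hasHilbertSymbol_of_finiteDimensional F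
  have hW := prod_ne_zero hw
  have h1 : (-1 : F) ≠ 0 := neg_ne_zero.2 one_ne_zero
  obtain ⟨u, hu, ⟨t, ht, hut⟩, hus⟩ : ∃ u : Fin (n + 2) → F, (∀ i, u i ≠ 0) ∧
      (∃ t, t ≠ 0 ∧ ∏ i, u i = -(∏ i, w i) * t ^ 2) ∧
      hasse (n + 2) u = hilbertSym (-1) (∏ i, w i) + hasse n w + 1 := by
    obtain ⟨n, rfl⟩ := Nat.exists_eq_add_of_le' hn
    exact H.exists_invariants (n + 1) (neg_ne_zero.2 hW) _
  have hU := prod_ne_zero hu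
  have hrep : ∀ w' : Fin n → F, (∀ i, w' i ≠ 0) →
      (QRep (diagQF (n + 2) u) (diagQF n w') ↔
        ¬ QuadraticMap.Equivalent (diagQF n w') (diagQF n w)) := by
    intro w' hw'
    have hW' := prod_ne_zero hw'
    rw [H.qrep_iff hu hw', H.equivalent_iff hw' hw, not_and]
    have hsq : IsSquare (-((∏ i, u i) * ∏ i, w' i)) ↔
        IsSquare ((∏ i, w' i) * ∏ i, w i) := by
      rw [hut, show -(-(∏ i, w i) * t ^ 2 * ∏ i, w' i) = (∏ i, w' i) * (∏ i, w i) * t ^ 2 by ring]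
      refine ⟨fun h => ?_, fun h => h.mul (.sq t)⟩
      have := h.div (IsSquare.sq t)
      rwa [mul_div_cancel_right₀ _ (pow_ne_zero 2 ht)] at this
    rw [hsq]
    refine forall_congr' fun hs => ?_
    rw [hus, hilbertSym_comm, hilbertSym_comm (-1),
      (H.isSquare_mul_iff hW' hW).1 hs (-1) h1]
    generalize hilbertSym (∏ i, w i) (-1) = p, hasse n w = q, hasse n w' = r
    revert p q r
    decide
  refine ⟨u, hu, hrep, fun u' hu' h => ?_, ⟨t, ht, hut⟩, fun e => ?_⟩
  · have hU' := prod_ne_zero hu'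
    have h := h w hw
    rw [H.qrep_iff hu' hw] at h
    obtain ⟨⟨s, hs⟩, hh⟩ := Classical.not_imp.1 (mt h.1 (not_not.2 (.refl _)))
    rw [H.equivalent_iff hu' hu]
    refine ⟨⟨s * t, by rw [hut]; linear_combination t ^ 2 * hs⟩, ?_⟩
    rw [hus]
    revert hh
    generalize hasse (n + 2) u' = x, hilbertSym (-1) (∏ i, w i) + hasse n w = y
    revert x y
    decide
  · refine (hrep w hw).1 (QRep.trans_equivalent (QRep.of_linearMap
      { toFun := fun x => Fin.append x 0
        map_add' := fun x y => ?_
        map_smul' := fun c x => ?_ } (fun x y hxy => ?_) fun x => ?_) e.symm) (.refl _)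
    · ext i
      refine Fin.addCases (fun i => ?_) (fun i => ?_) i <;> simp
    · ext i
      refine Fin.addCases (fun i => ?_) (fun i => ?_) i <;> simp
    · ext i
      simpa using congrFun hxy (Fin.castAdd 2 i)
    · simp [diagQF_apply, Fin.sum_univ_add]
end
end
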